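/- arXiv:1005.1424 — 8 statements merged into one kernel-verified Lean document; each statement's English description precedes it below -/
import Mathlib

section
/- Let A, B : Matrix n n ℝ≥0 commute under the max-product. If α : ℝ≥0 is an eigenvalue of A (i.e. there exists v ≠ 0 with A ⊗ v = α • v), then there exist μ : ℝ≥0 and a vector u : n → ℝ≥0 with u ≠ 0 such that A ⊗ u = α • u and B ⊗ u = μ • u; in particular the eigencone of A for α and the eigencone of B for μ intersect nontrivially. -/
open scoped NNReal

/-- Max-algebraic product of matrices over ℝ≥0. -/
noncomputable def maxMul {l m p : Type*} [Fintype m]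
    (A : Matrix l m ℝ≥0) (B : Matrix m p ℝ≥0) : Matrix l p ℝ≥0 :=
  fun i k => ⨆ j, A i j * B j k

/-- Max-algebraic action of a matrix on a vector over ℝ≥0. -/
noncomputable def maxVec {l m : Type*} [Fintype m]
    (A : Matrix l m ℝ≥0) (v : m → ℝ≥0) : l → ℝ≥0 :=
  fun i => ⨆ j, A i j * v j

theorem maxVec_apply_eq_sup {l m : Type*} [Fintype m] (A : Matrix l m ℝ≥0) (v : m → ℝ≥0) (i : l) :
    maxVec A v i = Finset.univ.sup fun j => A i j * v j :=
  (Finset.sup_univ_eq_ciSup _).symm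

theorem maxMul_apply_eq_sup {l m p : Type*} [Fintype m] (A : Matrix l m ℝ≥0) (B : Matrix m p ℝ≥0)
    (i : l) (k : p) : maxMul A B i k = Finset.univ.sup fun j => A i j * B j k :=
  (Finset.sup_univ_eq_ciSup _).symm

theorem continuous_maxVec {l m : Type*} [Fintype m] (A : Matrix l m ℝ≥0) :
    Continuous (maxVec A) := by
  refine continuous_pi fun i => ?_
  simp only [maxVec_apply_eq_sup]
  exact Continuous.finset_sup_apply fun j _ => by fun_prop

theorem maxVec_sup {l m : Type*} [Fintype m] (A : Matrix l m ℝ≥0) (v w : m → ℝ≥0) :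
    maxVec A (v ⊔ w) = maxVec A v ⊔ maxVec A w := by
  ext1 i
  simp only [Pi.sup_apply, maxVec_apply_eq_sup, ← Finset.sup_sup]
  refine Finset.sup_congr rfl fun j _ => ?_
  exact mul_max _ _ _

theorem maxVec_smul {l m : Type*} [Fintype m] (A : Matrix l m ℝ≥0) (c : ℝ≥0) (v : m → ℝ≥0) :
    maxVec A (c • v) = c • maxVec A v := by
  ext1 i
  simp only [Pi.smul_apply, smul_eq_mul, maxVec_apply_eq_sup, NNReal.mul_finset_sup]
  exact Finset.sup_congr rfl fun j _ => mul_left_comm _ _ _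

theorem maxVec_maxMul {l m p : Type*} [Fintype m] [Fintype p] (A : Matrix l m ℝ≥0)
    (B : Matrix m p ℝ≥0) (v : p → ℝ≥0) :
    maxVec (maxMul A B) v = maxVec A (maxVec B v) := by
  ext1 i
  simp only [maxVec_apply_eq_sup, maxMul_apply_eq_sup, NNReal.mul_finset_sup,
    NNReal.finset_sup_mul]
  rw [Finset.sup_comm]
  simp only [mul_assoc]

theorem NNReal.exists_le_smul_of_support_subset {n : Type*} [Fintype n] {x y : n → ℝ≥0}
    (h : Function.support x ⊆ Function.support y) : ∃ μ : ℝ≥0, x ≤ μ • y := by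
  refine ⟨Finset.univ.sup fun i => x i / y i, fun i => ?_⟩
  by_cases hx : x i = 0
  · simp [hx]
  have hy : y i ≠ 0 := h hx
  calc x i = x i / y i * y i := (div_mul_cancel₀ _ hy).symm
    _ ≤ _ := mul_le_mul_left (Finset.le_sup (f := fun i => x i / y i) (Finset.mem_univ i)) _

/-- A max-cone: a set of nonnegative vectors closed under suprema and scaling. -/
structure IsMaxCone {n : Type*} (W : Set (n → ℝ≥0)) : Prop where
  sup_mem : ∀ x ∈ W, ∀ y ∈ W, x ⊔ y ∈ W
  smul_mem : ∀ (c : ℝ≥0), ∀ x ∈ W, c • x ∈ W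

/-- A max-linear map: one that preserves suprema and scaling. -/
structure IsMaxLinear {n : Type*} (T : (n → ℝ≥0) → n → ℝ≥0) : Prop where
  map_sup : ∀ x y, T (x ⊔ y) = T x ⊔ T y
  map_smul : ∀ (c : ℝ≥0) x, T (c • x) = c • T x

namespace IsMaxLinear

variable {n : Type*} {T : (n → ℝ≥0) → n → ℝ≥0} {W : Set (n → ℝ≥0)}

theorem monotone (hT : IsMaxLinear T) : Monotone T := fun x y h => by
  rw [← sup_eq_right.2 h, hT.map_sup]
  exact le_sup_left

theorem map_bot (hT : IsMaxLinear T) : T ⊥ = ⊥ := by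
  have := hT.map_smul 0 ⊥
  rwa [zero_smul, zero_smul] at this

theorem const_smul (hT : IsMaxLinear T) (c : ℝ≥0) : IsMaxLinear fun x => c • T x where
  map_sup x y := by
    ext1 i
    simp only [hT.map_sup, Pi.smul_apply, Pi.sup_apply, smul_eq_mul]
    exact mul_max _ _ _
  map_smul d x := by rw [hT.map_smul, smul_comm]

theorem iterate_const_smul (hT : IsMaxLinear T) (c : ℝ≥0) (k : ℕ) (x : n → ℝ≥0) :
    (fun x => c • T x)^[k] x = c ^ k • T^[k] x := by
  induction k with
  | zero => simp
  | succ k ih =>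
    rw [Function.iterate_succ_apply', ih, Function.iterate_succ_apply', hT.map_smul, smul_smul,
      pow_succ']

theorem map_sup_iterate (hT : IsMaxLinear T) (k : ℕ) (v : n → ℝ≥0) :
    T ((Finset.range k).sup fun j => T^[j] v) = (Finset.range k).sup fun j => T^[j + 1] v := by
  rw [Finset.apply_sup_eq_sup_comp T hT.map_sup hT.map_bot]
  simp only [Function.comp_def, Function.iterate_succ_apply']

theorem sup_iterate_mem (hW : IsMaxCone W) (hTW : Set.MapsTo T W W) {v : n → ℝ≥0} (hv : v ∈ W)
    (k : ℕ) : ((Finset.range k).sup fun j => T^[j] v) ∈ W :=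
  Finset.sup_mem W ((zero_smul ℝ≥0 v).subst (motive := (· ∈ W)) (hW.smul_mem 0 v hv))
    hW.sup_mem _ _ fun j _ =>
    hTW.iterate j hv

/-- If an iterate of a max-linear map decreases `v`, then the map decreases some vector
above `v`. -/
theorem exists_map_le_of_iterate_le (hT : IsMaxLinear T) (hW : IsMaxCone W)
    (hTW : Set.MapsTo T W W) {v : n → ℝ≥0} (hv : v ∈ W) {k : ℕ} (hk : 0 < k)
    (h : T^[k] v ≤ v) : ∃ u ∈ W, v ≤ u ∧ T u ≤ u := by
  have hvu : v ≤ (Finset.range k).sup fun j => T^[j] v :=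
    Finset.le_sup (f := fun j => T^[j] v) (Finset.mem_range.2 hk)
  refine ⟨_, sup_iterate_mem hW hTW hv k, hvu, ?_⟩
  rw [hT.map_sup_iterate]
  refine Finset.sup_le fun j hj => ?_
  rcases (Nat.succ_le_of_lt (Finset.mem_range.1 hj)).lt_or_eq with hlt | heq
  · exact Finset.le_sup (f := fun j => T^[j] v) (Finset.mem_range.2 hlt)
  · rw [← Nat.succ_eq_add_one, heq]
    exact h.trans hvu

theorem exists_map_le_smul [Fintype n] (hT : IsMaxLinear T) (hW : IsMaxCone W)
    (hTW : Set.MapsTo T W W) {v : n → ℝ≥0} (hv : v ∈ W) (hv0 : v ≠ 0) :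
    ∃ (μ : ℝ≥0) (u : n → ℝ≥0), u ∈ W ∧ u ≠ 0 ∧ T u ≤ μ • u := by
  let s : ℕ → n → ℝ≥0 := fun k => (Finset.range k).sup fun j => T^[j] v
  have hs : Monotone s := fun a b hab => Finset.sup_mono (Finset.range_mono hab)
  let S : ℕ →o Set n := ⟨fun k => Function.support (s k), fun a b hab i hi =>
    ((pos_iff_ne_zero.2 hi).trans_le (hs hab i)).ne'⟩
  obtain ⟨k, hk⟩ := WellFoundedGT.monotone_chain_condition S
  have hTs : T (s (k + 1)) ≤ s (k + 2) := by
    simp only [s]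
    rw [hT.map_sup_iterate]
    refine Finset.sup_le fun j hj => ?_
    exact Finset.le_sup (f := fun j => T^[j] v)
      (Finset.mem_range.2 (Nat.succ_lt_succ (Finset.mem_range.1 hj)))
  have hsupp : Function.support (s (k + 2)) ⊆ Function.support (s (k + 1)) :=
    ((hk (k + 2) (by omega)).symm.trans (hk (k + 1) (by omega))).le
  obtain ⟨μ, hμ⟩ := NNReal.exists_le_smul_of_support_subset hsupp
  refine ⟨μ, s (k + 1), sup_iterate_mem hW hTW hv _, ?_, hTs.trans hμ⟩
  have hvs : v ≤ s (k + 1) := Finset.le_sup (f := fun j => T^[j] v) (Finset.mem_range.2 k.succ_pos)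
  exact ((bot_lt_iff_ne_bot.2 hv0).trans_le hvs).ne'

/-- A vector realising the least `μ` with `T u ≤ μ • u` for some nonzero `u ∈ W`. -/
theorem exists_minimal_map_le_smul [Fintype n] (hT : IsMaxLinear T) (hTc : Continuous T)
    (hW : IsMaxCone W) (hWc : IsClosed W) (hTW : Set.MapsTo T W W) {v : n → ℝ≥0} (hv : v ∈ W)
    (hv0 : v ≠ 0) :
    ∃ (ρ : ℝ≥0) (u : n → ℝ≥0), (u ∈ W ∧ u ≠ 0 ∧ T u ≤ ρ • u) ∧
      ∀ (μ : ℝ≥0), ∀ x ∈ W, x ≠ 0 → T x ≤ μ • x → ρ ≤ μ := by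
  have normalize : ∀ (μ : ℝ≥0), ∀ x ∈ W, x ≠ 0 → T x ≤ μ • x →
      ∃ y ∈ W, y ≤ 1 ∧ (∃ i, y i = 1) ∧ T y ≤ μ • y := by
    intro μ x hx hx0 hμ
    obtain ⟨i₀, hi₀⟩ := Function.ne_iff.1 hx0
    obtain ⟨i, -, hi⟩ := Finset.exists_max_image Finset.univ x ⟨i₀, Finset.mem_univ _⟩
    have hxi : 0 < x i := (pos_iff_ne_zero.2 hi₀).trans_le (hi i₀ (Finset.mem_univ _))
    refine ⟨(x i)⁻¹ • x, hW.smul_mem _ x hx, fun j => ?_, ⟨i, inv_mul_cancel₀ hxi.ne'⟩, ?_⟩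
    · exact (mul_le_mul_right (hi j (Finset.mem_univ _)) _).trans_eq (inv_mul_cancel₀ hxi.ne')
    · rw [hT.map_smul, smul_comm]
      exact smul_le_smul_of_nonneg_left hμ zero_le
  obtain ⟨μ₀, x₀, hx₀, hx₀0, hμ₀⟩ := hT.exists_map_le_smul hW hTW hv hv0
  let C : Set ((n → ℝ≥0) × ℝ≥0) :=
    {p | p.1 ∈ W ∧ (∃ i, p.1 i = 1) ∧ T p.1 ≤ p.2 • p.1}
  have hC : IsClosed C := by
    have hone : IsClosed {p : (n → ℝ≥0) × ℝ≥0 | ∃ i, p.1 i = 1} := by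
      rw [Set.ofPred_exists]
      exact isClosed_iUnion_of_finite fun i => isClosed_eq (by fun_prop) continuous_const
    have hle : IsClosed {p : (n → ℝ≥0) × ℝ≥0 | T p.1 ≤ p.2 • p.1} :=
      isClosed_le (by fun_prop) (by fun_prop)
    exact (hWc.preimage continuous_fst).inter (hone.inter hle)
  have hK : IsCompact ((Set.Icc (0 : n → ℝ≥0) 1 ×ˢ Set.Icc 0 μ₀) ∩ C) :=
    (isCompact_Icc.prod isCompact_Icc).inter_right hC
  obtain ⟨y₀, hy₀, hy₀1, hy₀e, hy₀T⟩ := normalize μ₀ x₀ hx₀ hx₀0 hμ₀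
  obtain ⟨⟨u, ρ⟩, ⟨⟨-, hρ⟩, hu, ⟨i, hi⟩, huT⟩, hmin⟩ :=
    hK.exists_isMinOn ⟨(y₀, μ₀), ⟨⟨zero_le, hy₀1⟩, ⟨zero_le, le_rfl⟩⟩, hy₀, hy₀e, hy₀T⟩
      continuous_snd.continuousOn
  refine ⟨ρ, u, ⟨hu, fun h => ?_, huT⟩, fun μ x hx hx0 hμ => ?_⟩
  · simp [h] at hi
  rcases le_total μ μ₀ with hle | hle
  · obtain ⟨y, hy, hy1, hye, hyT⟩ := normalize μ x hx hx0 hμ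
    exact hmin (show (y, μ) ∈ _ from ⟨⟨⟨zero_le, hy1⟩, ⟨zero_le, hle⟩⟩, hy, hye, hyT⟩)
  · exact hρ.2.trans hle

/-- A continuous max-linear map has an eigenvector in every nonzero closed invariant max-cone. -/
theorem exists_eigenvector [Fintype n] (hT : IsMaxLinear T) (hTc : Continuous T)
    (hW : IsMaxCone W) (hWc : IsClosed W) (hTW : Set.MapsTo T W W) {v : n → ℝ≥0} (hv : v ∈ W)
    (hv0 : v ≠ 0) : ∃ (μ : ℝ≥0) (u : n → ℝ≥0), u ∈ W ∧ u ≠ 0 ∧ T u = μ • u := by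
  obtain ⟨ρ, u, ⟨hu, hu0, huT⟩, hmin⟩ := hT.exists_minimal_map_le_smul hTc hW hWc hTW hv hv0
  rcases eq_or_ne ρ 0 with rfl | hρ
  · exact ⟨0, u, hu, hu0, le_antisymm huT (by simp)⟩
  let S : (n → ℝ≥0) → n → ℝ≥0 := fun x => ρ⁻¹ • T x
  have hS : IsMaxLinear S := hT.const_smul _
  have hSc : Continuous S := by fun_prop
  have hSW : Set.MapsTo S W W := fun x hx => hW.smul_mem _ _ (hTW hx)
  have hTS : ∀ x, T x = ρ • S x := fun x => (smul_inv_smul₀ hρ _).symm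
  have hSu : S u ≤ u := by
    have := smul_le_smul_of_nonneg_left huT (zero_le (a := ρ⁻¹))
    rwa [inv_smul_smul₀ hρ] at this
  have hanti : Antitone fun k => S^[k] u := hS.monotone.antitone_iterate_of_map_le hSu
  have hlim : Filter.Tendsto (fun k => S^[k] u) Filter.atTop (nhds (⨅ k, S^[k] u)) := by
    exact tendsto_atTop_ciInf hanti (OrderBot.bddBelow _)
  set w := ⨅ k, S^[k] u
  have hw : S w = w := isFixedPt_of_tendsto_iterate hlim hSc.continuousAt
  have hwW : w ∈ W := hWc.mem_of_tendsto hlim (.of_forall fun k => hSW.iterate k hu)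
  rcases ne_or_eq w 0 with hw0 | hw0
  · exact ⟨ρ, w, hwW, hw0, by rw [hTS, hw]⟩
  exfalso
  rw [hw0] at hlim
  have hhalf : ∀ᶠ k in Filter.atTop, S^[k] u ≤ (1 / 2 : ℝ≥0) • u := by
    refine Filter.eventually_all.2 fun i => ?_
    rcases eq_or_ne (u i) 0 with hi | hi
    · exact .of_forall fun k => (hanti k.zero_le i).trans (by simp [hi])
    · have hpos : (0 : n → ℝ≥0) i < ((1 / 2 : ℝ≥0) • u) i := by
        simpa using pos_iff_ne_zero.2 hi
      exact ((tendsto_pi_nhds.1 hlim i).eventually_lt_const hpos).mono fun k hk => hk.le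
  obtain ⟨k, hk, hkpos⟩ := (hhalf.and (Filter.eventually_gt_atTop 0)).exists
  obtain ⟨c, hc0, hc1, hck⟩ : ∃ c : ℝ≥0, c ≠ 0 ∧ c < 1 ∧ c ^ k = 1 / 2 := by
    have h : ((1 / 2 : ℝ≥0) ^ (k : ℝ)⁻¹) ^ k = 1 / 2 := NNReal.rpow_inv_natCast_pow _ hkpos.ne'
    refine ⟨_, fun h0 => ?_, ?_, h⟩
    · rw [h0, zero_pow hkpos.ne'] at h
      simp at h
    · exact NNReal.rpow_lt_one (NNReal.half_lt_self one_ne_zero) (by positivity)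
  obtain ⟨x, hx, hux, hxS⟩ := (hS.const_smul c⁻¹).exists_map_le_of_iterate_le hW
    (fun x hx => hW.smul_mem _ _ (hSW hx)) hu hkpos (by
      rw [hS.iterate_const_smul, inv_pow, hck]
      refine (smul_le_smul_of_nonneg_left hk zero_le).trans_eq ?_
      exact inv_smul_smul₀ (by simp) u)
  have hSx : S x ≤ c • x := by
    have := smul_le_smul_of_nonneg_left hxS (zero_le (a := c))
    rwa [smul_inv_smul₀ hc0] at this
  have hle : ρ ≤ ρ * c := hmin _ x hx ((bot_lt_iff_ne_bot.2 hu0).trans_le hux).ne' (by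
    rw [hTS, mul_smul]
    exact smul_le_smul_of_nonneg_left hSx zero_le)
  exact hle.not_gt (mul_lt_of_lt_one_right (pos_iff_ne_zero.2 hρ) hc1)

end IsMaxLinear

theorem isMaxLinear_maxVec {n : Type*} [Fintype n] (A : Matrix n n ℝ≥0) :
    IsMaxLinear (maxVec A) :=
  ⟨maxVec_sup A, maxVec_smul A⟩

theorem isMaxCone_eigencone {n : Type*} [Fintype n] (A : Matrix n n ℝ≥0) (α : ℝ≥0) :
    IsMaxCone {u | maxVec A u = α • u} where
  sup_mem x hx y hy := by
    simp only [Set.mem_ofPred_eq] at hx hy ⊢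
    rw [maxVec_sup, hx, hy]
    ext1 i
    exact (mul_max α (x i) (y i)).symm
  smul_mem c x hx := by
    simp only [Set.mem_ofPred_eq] at hx ⊢
    rw [maxVec_smul, hx, smul_comm]

theorem common_eigenvector_of_commute {n : Type*} [Fintype n]
    (A B : Matrix n n ℝ≥0) (hcomm : maxMul A B = maxMul B A)
    (α : ℝ≥0) (hα : ∃ v : n → ℝ≥0, v ≠ 0 ∧ maxVec A v = α • v) :
    ∃ (μ : ℝ≥0) (u : n → ℝ≥0), u ≠ 0 ∧ maxVec A u = α • u ∧ maxVec B u = μ • u := by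
  obtain ⟨v, hv0, hv⟩ := hα
  have hBW : Set.MapsTo (maxVec B) {u | maxVec A u = α • u} {u | maxVec A u = α • u} := by
    intro x (hx : maxVec A x = α • x)
    simp only [Set.mem_ofPred_eq]
    rw [← maxVec_maxMul, hcomm, maxVec_maxMul, hx, maxVec_smul]
  obtain ⟨μ, u, hu, hu0, huB⟩ := (isMaxLinear_maxVec B).exists_eigenvector (continuous_maxVec B)
    (isMaxCone_eigencone A α) (isClosed_eq (continuous_maxVec A) (continuous_const_smul α))
    hBW hv hv0
  exact ⟨μ, u, hu0, hu, huB⟩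
end

section
/- Let A : Fin r → Matrix n n ℝ≥0 commute in pairs under the max-product, and let p be a max polynomial in r variables, given by a finite set s of monomials with coefficients c : s → ℝ≥0 and exponent vectors e : s → (Fin r → ℕ). Write p(A) for the matrix ⨆_{m ∈ s} c m • ((A 0)^(e m 0) ⊗ (A 1)^(e m 1) ⊗ ⋯ ⊗ (A (r-1))^(e m (r-1))) (entrywise finite supremum of scaled ordered max-products of max-powers), and for α : Fin r → ℝ≥0 write p(α) = ⨆_{m ∈ s} c m * ∏ j, (α j)^(e m j). Then: (i) for each i₀ : Fin r and each eigenvalue α₀ of A i₀, there exists α : Fin r → ℝ≥0 with α i₀ = α₀ such that each α j is an eigenvalue of A j and p(α) is an eigenvalue of p(A); (ii) for every eigenvalue λ of p(A) there exists α : Fin r → ℝ≥0 such that each α j is an eigenvalue of A j and λ = p(α). -/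
open scoped NNReal

/-- Max-algebraic power of a square matrix, with `M^0` the identity matrix. -/
noncomputable def maxPow {n : Type*} [Fintype n] [DecidableEq n]
    (M : Matrix n n ℝ≥0) : ℕ → Matrix n n ℝ≥0
  | 0 => 1
  | k + 1 => maxMul M (maxPow M k)

/-- Ordered max-product of a list of square matrices (empty product = identity). -/
noncomputable def maxProdList {n : Type*} [Fintype n] [DecidableEq n]
    (l : List (Matrix n n ℝ≥0)) : Matrix n n ℝ≥0 :=
  l.foldr maxMul 1

/-- `α` is a max-algebraic eigenvalue of `A`. -/
def IsMaxEig {n : Type*} [Fintype n] (A : Matrix n n ℝ≥0) (α : ℝ≥0) : Prop :=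
  ∃ v : n → ℝ≥0, v ≠ 0 ∧ maxVec A v = α • v

/-- A continuous self-map of `n → ℝ≥0` that is linear over the max-times semiring. -/
structure IsMaxLinear_s5 {n : Type*} (f : (n → ℝ≥0) → (n → ℝ≥0)) : Prop where
  continuous : Continuous f
  map_sup : ∀ u v, f (u ⊔ v) = f u ⊔ f v
  map_smul : ∀ (a : ℝ≥0) u, f (a • u) = a • f u

/-- A closed subset of `n → ℝ≥0` that is stable under binary suprema and scaling. -/
structure IsClosedMaxCone {n : Type*} (W : Set (n → ℝ≥0)) : Prop where
  isClosed : IsClosed W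
  sup_mem : ∀ u ∈ W, ∀ v ∈ W, u ⊔ v ∈ W
  smul_mem : ∀ (a : ℝ≥0), ∀ u ∈ W, a • u ∈ W

namespace IsMaxLinear_s5

variable {n : Type*} {f : (n → ℝ≥0) → (n → ℝ≥0)} {W : Set (n → ℝ≥0)}

theorem monotone_s5 (hf : IsMaxLinear_s5 f) : Monotone f := fun u v h => by
  rw [← sup_eq_right, ← hf.map_sup, sup_eq_right.2 h]

theorem map_zero (hf : IsMaxLinear_s5 f) : f 0 = 0 := by
  simpa using hf.map_smul 0 0

theorem isClosedMaxCone_eigenspace (hf : IsMaxLinear_s5 f) (a : ℝ≥0) :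
    IsClosedMaxCone {v | f v = a • v} where
  isClosed := isClosed_eq hf.continuous (continuous_const_smul a)
  sup_mem u hu v hv := by
    simp only [Set.mem_ofPred_eq] at hu hv ⊢
    rw [hf.map_sup, hu, hv]
    ext i
    simp [NNReal.mul_sup]
  smul_mem b u hu := by
    simp only [Set.mem_ofPred_eq] at hu ⊢
    rw [hf.map_smul, hu, smul_comm]

end IsMaxLinear_s5

theorem IsClosedMaxCone.inter {n : Type*} {V W : Set (n → ℝ≥0)} (hV : IsClosedMaxCone V)
    (hW : IsClosedMaxCone W) : IsClosedMaxCone (V ∩ W) where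
  isClosed := hV.isClosed.inter hW.isClosed
  sup_mem u hu v hv := ⟨hV.sup_mem u hu.1 v hv.1, hW.sup_mem u hu.2 v hv.2⟩
  smul_mem a u hu := ⟨hV.smul_mem a u hu.1, hW.smul_mem a u hu.2⟩

/-- A nonzero cone contains an element dominating every other one up to scaling. -/
theorem IsClosedMaxCone.exists_dominating {n : Type*} [Fintype n] {W : Set (n → ℝ≥0)}
    (hW : IsClosedMaxCone W) (hne : ∃ v ∈ W, v ≠ 0) :
    ∃ v ∈ W, v ≠ 0 ∧ ∀ w ∈ W, ∃ a : ℝ≥0, w ≤ a • v := by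
  obtain ⟨v₀, hv₀, hv₀0⟩ := hne
  obtain ⟨T, hT⟩ := (Set.toFinite (Function.support '' W)).exists_maximal ⟨_, v₀, hv₀, rfl⟩
  obtain ⟨⟨v, hv, rfl⟩, hmax⟩ := hT
  have key : ∀ w ∈ W, ∀ i, v i = 0 → w i = 0 := by
    intro w hw i hi
    by_contra hwi
    have h := @hmax _ ⟨v ⊔ w, hW.sup_mem v hv w hw, rfl⟩ (fun j hj => by
      simp only [Function.mem_support, Pi.sup_apply] at hj ⊢
      exact (lt_of_lt_of_le (pos_iff_ne_zero.2 hj) le_sup_left).ne')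
    have : i ∈ Function.support v := h (by
      simp only [Function.mem_support, Pi.sup_apply]
      exact (lt_of_lt_of_le (pos_iff_ne_zero.2 hwi) le_sup_right).ne')
    exact this hi
  refine ⟨v, hv, fun h => hv₀0 ?_, fun w hw => ?_⟩
  · ext i
    simp [key v₀ hv₀ i (by simp [h])]
  · refine ⟨Finset.univ.sup fun i => w i / v i, fun i => ?_⟩
    by_cases hi : v i = 0
    · simp [key w hw i hi]
    · calc w i = w i / v i * v i := by field_simp
        _ ≤ _ := by
          simp only [Pi.smul_apply, smul_eq_mul]
          gcongr
          exact Finset.le_sup (f := fun i => w i / v i) (Finset.mem_univ i)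

namespace IsMaxLinear_s5

variable {n : Type*} {f : (n → ℝ≥0) → (n → ℝ≥0)} {W : Set (n → ℝ≥0)}

/-- The least `r` for which some nonzero `u ∈ W` satisfies `f u ≤ r • u`. -/
theorem exists_min_subeigenvalue [Fintype n] (hf : IsMaxLinear_s5 f) (hW : IsClosedMaxCone W)
    (hfW : Set.MapsTo f W W) (hne : ∃ v ∈ W, v ≠ 0) :
    ∃ r : ℝ≥0, ∃ u ∈ W, u ≠ 0 ∧ f u ≤ r • u ∧
      ∀ b : ℝ≥0, ∀ v ∈ W, v ≠ 0 → f v ≤ b • v → r ≤ b := by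
  have normalize : ∀ (b : ℝ≥0), ∀ v ∈ W, v ≠ 0 → f v ≤ b • v →
      ∃ u ∈ W, u ≤ 1 ∧ (∃ i, u i = 1) ∧ f u ≤ b • u := by
    intro b v hv hv0 hb
    obtain ⟨j, hj⟩ := Function.ne_iff.1 hv0
    obtain ⟨i, -, hi⟩ := Finset.univ.exists_max_image v ⟨j, Finset.mem_univ j⟩
    have hi0 : v i ≠ 0 := (lt_of_lt_of_le (pos_iff_ne_zero.2 hj) (hi j (Finset.mem_univ j))).ne'
    refine ⟨(v i)⁻¹ • v, hW.smul_mem _ _ hv, fun k => ?_, ⟨i, ?_⟩, ?_⟩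
    · calc (v i)⁻¹ * v k ≤ (v i)⁻¹ * v i := by gcongr; exact hi k (Finset.mem_univ k)
        _ = 1 := inv_mul_cancel₀ hi0
    · exact inv_mul_cancel₀ hi0
    · rw [hf.map_smul, smul_comm]
      intro k
      exact mul_le_mul_right (hb k) _
  obtain ⟨v, hv, hv0, hdom⟩ := hW.exists_dominating hne
  obtain ⟨a, ha⟩ := hdom _ (hfW hv)
  let K : Set (ℝ≥0 × (n → ℝ≥0)) := Set.Icc 0 a ×ˢ Set.Icc 0 1 ∩
    {x | x.2 ∈ W ∧ (∃ i, x.2 i = 1) ∧ f x.2 ≤ x.1 • x.2}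
  have hK : IsCompact K := by
    refine (isCompact_Icc.prod isCompact_Icc).inter_right ?_
    refine (hW.isClosed.preimage continuous_snd).inter (IsClosed.inter ?_ ?_)
    · have : {x : ℝ≥0 × (n → ℝ≥0) | ∃ i, x.2 i = 1} = ⋃ i, {x | x.2 i = 1} := by
        ext x
        simp
      change IsClosed {x : ℝ≥0 × (n → ℝ≥0) | ∃ i, x.2 i = 1}
      rw [this]
      exact isClosed_iUnion_of_finite fun i => isClosed_eq (by fun_prop) continuous_const
    · exact isClosed_le (hf.continuous.comp continuous_snd) (by fun_prop)
  have hKmem : ∀ b ≤ a, ∀ v ∈ W, v ≠ 0 → f v ≤ b • v → ∃ u, (b, u) ∈ K := by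
    intro b hb v hv hv0 hbv
    obtain ⟨u, hu, hu1, hi, hbu⟩ := normalize b v hv hv0 hbv
    exact ⟨u, ⟨⟨zero_le, hb⟩, fun _ => zero_le, hu1⟩, hu, hi, hbu⟩
  obtain ⟨u₀, hu₀⟩ := hKmem a le_rfl v hv hv0 ha
  obtain ⟨⟨r, u⟩, ⟨⟨hra, -⟩, huW, ⟨i, hi⟩, hru⟩, hmin⟩ :=
    hK.exists_isMinOn ⟨_, hu₀⟩ continuous_fst.continuousOn
  refine ⟨r, u, huW, ?_, hru, fun b w hw hw0 hbw => ?_⟩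
  · rintro rfl
    simp at hi
  · rcases le_total b a with hb | hb
    · obtain ⟨x, hx⟩ := hKmem b hb w hw hw0 hbw
      exact hmin hx
    · exact hra.2.trans hb

theorem exists_subeigenvector_of_iterate_le (hf : IsMaxLinear_s5 f) (hW : IsClosedMaxCone W)
    (hfW : Set.MapsTo f W W) {u : n → ℝ≥0} (hu : u ∈ W) (hu0 : u ≠ 0) {a : ℝ≥0} (ha : a ≠ 0)
    {m : ℕ} (hm : m ≠ 0) (h : f^[m] u ≤ a ^ m • u) :
    ∃ v ∈ W, v ≠ 0 ∧ f v ≤ a • v := by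
  set g : ℕ → n → ℝ≥0 := fun k => (a⁻¹) ^ k • f^[k] u with hg
  have hu_le : u ≤ (Finset.range m).sup g := by
    have := Finset.le_sup (f := g) (Finset.mem_range.2 (Nat.pos_of_ne_zero hm))
    simpa [hg] using this
  refine ⟨(Finset.range m).sup g, ?_, ?_, ?_⟩
  · refine Finset.sup_induction (p := (· ∈ W)) ?_ (fun x hx y hy => hW.sup_mem x hx y hy)
      fun k _ => hW.smul_mem _ _ (hfW.iterate k hu)
    have h := hW.smul_mem 0 u hu
    rwa [zero_smul] at h
  · intro h0
    exact hu0 (le_antisymm (h0 ▸ hu_le) fun _ => zero_le)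
  · have hstep : ∀ k, f (g k) = a • g (k + 1) := by
      intro k
      simp only [hg, hf.map_smul, Function.iterate_succ_apply', smul_smul, pow_succ']
      rw [mul_inv_cancel_left₀ ha]
    rw [Finset.apply_sup_eq_sup_comp f hf.map_sup hf.map_zero]
    refine Finset.sup_le fun k hk => ?_
    rw [Function.comp_apply, hstep]
    refine fun i => mul_le_mul_right ?_ a
    rcases Nat.lt_or_ge (k + 1) m with hkm | hkm
    · exact Finset.le_sup (f := g) (Finset.mem_range.2 hkm) i
    · obtain rfl : m = k + 1 := le_antisymm hkm (Finset.mem_range.1 hk)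
      refine le_trans ?_ (hu_le i)
      calc a⁻¹ ^ (k + 1) * f^[k + 1] u i ≤ a⁻¹ ^ (k + 1) * (a ^ (k + 1) * u i) := by
            gcongr
            exact h i
        _ = u i := by rw [← mul_assoc, ← mul_pow, inv_mul_cancel₀ ha, one_pow, one_mul]

/-- A max-linear map preserving a nonzero closed max-cone has an eigenvector in it. -/
theorem exists_eigenvector_s5 [Fintype n] (hf : IsMaxLinear_s5 f) (hW : IsClosedMaxCone W)
    (hfW : Set.MapsTo f W W) (hne : ∃ v ∈ W, v ≠ 0) :
    ∃ a : ℝ≥0, ∃ v ∈ W, v ≠ 0 ∧ f v = a • v := by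
  obtain ⟨r, u, huW, hu0, hru, hmin⟩ := hf.exists_min_subeigenvalue hW hfW hne
  rcases eq_or_ne r 0 with rfl | hr
  · exact ⟨0, u, huW, hu0, le_antisymm hru fun i => by simp⟩
  set g : ℕ → n → ℝ≥0 := fun k => (r⁻¹) ^ k • f^[k] u with hg
  have hstep : ∀ k, f (g k) = r • g (k + 1) := by
    intro k
    simp only [hg, hf.map_smul, Function.iterate_succ_apply', smul_smul, pow_succ']
    rw [mul_inv_cancel_left₀ hr]
  have hanti : Antitone g := antitone_nat_of_succ_le fun k => by
    induction k with
    | zero =>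
      intro i
      simpa [hg, inv_mul_le_iff₀ (pos_iff_ne_zero.2 hr)] using hru i
    | succ k ih =>
      have h := hf.monotone_s5 ih
      rw [hstep, hstep] at h
      exact fun i => le_of_mul_le_mul_left (h i) (pos_iff_ne_zero.2 hr)
  have hlim : Filter.Tendsto g Filter.atTop (nhds fun i => ⨅ k, g k i) :=
    tendsto_pi_nhds.2 fun i => tendsto_atTop_ciInf (fun k l hkl => hanti hkl i)
      (OrderBot.bddBelow _)
  set w : n → ℝ≥0 := fun i => ⨅ k, g k i
  have hwW : w ∈ W := hW.isClosed.mem_of_tendsto hlim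
    (Filter.Eventually.of_forall fun k => hW.smul_mem _ _ (hfW.iterate k huW))
  have hfw : f w = r • w := by
    refine tendsto_nhds_unique ((hf.continuous.tendsto w).comp hlim) ?_
    have := (((Filter.tendsto_add_atTop_iff_nat 1).2 hlim).const_smul r)
    exact this.congr fun k => (hstep k).symm
  refine ⟨r, w, hwW, fun hw0 => ?_, hfw⟩
  have hev : ∀ i, ∀ᶠ k in Filter.atTop, g k i ≤ 2⁻¹ * u i := by
    intro i
    rcases eq_or_ne (u i) 0 with hi | hi
    · refine Filter.Eventually.of_forall fun k => ?_
      have := hanti (Nat.zero_le k) i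
      simpa [hg, hi] using this
    · have h := tendsto_pi_nhds.1 hlim i
      rw [hw0] at h
      exact (h.eventually_lt_const (u := 2⁻¹ * u i)
        (by simpa using pos_iff_ne_zero.2 hi)).mono fun k hk => hk.le
  obtain ⟨m, hm, hm0⟩ := ((Filter.eventually_all.2 hev).and (Filter.eventually_ne_atTop 0)).exists
  set c : ℝ≥0 := (2⁻¹ : ℝ≥0) ^ ((m : ℝ)⁻¹)
  have hcm : c ^ m = 2⁻¹ := NNReal.rpow_inv_natCast_pow _ hm0
  have hc0 : c ≠ 0 := by
    intro h
    rw [h, zero_pow hm0] at hcm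
    simp at hcm
  have hc1 : c < 1 := by
    by_contra! h
    have := one_le_pow₀ h (n := m)
    rw [hcm] at this
    exact absurd this (by rw [not_le]; exact NNReal.inv_lt_one_iff (by simp) |>.2 (by norm_num))
  obtain ⟨v, hv, hv0, hfv⟩ := hf.exists_subeigenvector_of_iterate_le hW hfW huW hu0
    (mul_ne_zero hr hc0) hm0 (fun i => by
      have h := hm i
      simp only [hg, Pi.smul_apply, smul_eq_mul] at h ⊢
      rw [mul_pow, hcm, mul_assoc]
      rwa [inv_pow, inv_mul_le_iff₀ (by positivity)] at h)
  have := hmin _ v hv hv0 hfv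
  exact absurd this (not_le.2 (mul_lt_of_lt_one_right (pos_iff_ne_zero.2 hr) hc1))

/-- Pairwise commuting max-linear maps preserving a nonzero closed max-cone have a common
eigenvector in it. -/
theorem exists_common_eigenvector [Fintype n] {κ : Type*} {f : κ → (n → ℝ≥0) → (n → ℝ≥0)}
    (hf : ∀ k, IsMaxLinear_s5 (f k)) (hcomm : ∀ k l v, f k (f l v) = f l (f k v)) (t : Finset κ)
    (hW : IsClosedMaxCone W) (hfW : ∀ k, Set.MapsTo (f k) W W) (hne : ∃ v ∈ W, v ≠ 0) :
    ∃ v ∈ W, v ≠ 0 ∧ ∀ k ∈ t, ∃ a : ℝ≥0, f k v = a • v := by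
  classical
  induction t using Finset.induction_on generalizing W with
  | empty => simpa using hne
  | insert k t _ ih =>
    obtain ⟨a, v, hv, hv0, hav⟩ := (hf k).exists_eigenvector_s5 hW (hfW k) hne
    obtain ⟨w, hw, hw0, hwt⟩ := ih (hW.inter ((hf k).isClosedMaxCone_eigenspace a))
      (fun l x hx => ⟨hfW l hx.1, by
        have hx2 : f k x = a • x := hx.2
        rw [Set.mem_ofPred_eq, hcomm, hx2, (hf l).map_smul]⟩) ⟨v, ⟨hv, hav⟩, hv0⟩
    refine ⟨w, hw.1, hw0, fun l hl => ?_⟩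
    rcases Finset.mem_insert.1 hl with rfl | hl
    · exact ⟨a, hw.2⟩
    · exact hwt l hl

end IsMaxLinear_s5

section MaxAction

variable {n : Type*} [Fintype n]

theorem maxVec_eq_sup (M : Matrix n n ℝ≥0) (v : n → ℝ≥0) (i : n) :
    maxVec M v i = Finset.univ.sup fun j => M i j * v j :=
  (Finset.sup_univ_eq_ciSup _).symm

theorem isMaxLinear_maxVec_s5 (M : Matrix n n ℝ≥0) : IsMaxLinear_s5 (maxVec M) where
  continuous := continuous_pi fun i => by
    simp only [maxVec_eq_sup]
    exact Continuous.finset_sup_apply fun j _ => by fun_prop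
  map_sup u v := by
    funext i
    simp only [maxVec_eq_sup, Pi.sup_apply, ← Finset.sup_sup]
    exact Finset.sup_congr rfl fun j _ => NNReal.mul_sup _ _ _
  map_smul a u := by
    funext i
    simp only [maxVec_eq_sup, Pi.smul_apply, smul_eq_mul, NNReal.mul_finset_sup, mul_left_comm]

theorem maxVec_maxMul_s5 (M N : Matrix n n ℝ≥0) (v : n → ℝ≥0) :
    maxVec (maxMul M N) v = maxVec M (maxVec N v) := by
  ext i
  simp only [maxVec_eq_sup, maxMul, ← Finset.sup_univ_eq_ciSup, NNReal.mul_finset_sup,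
    NNReal.finset_sup_mul, mul_assoc]
  rw [Finset.sup_comm]

theorem maxVec_finset_sup {ι : Type*} (s : Finset ι) (c : ι → ℝ≥0) (M : ι → Matrix n n ℝ≥0)
    (v : n → ℝ≥0) :
    maxVec (fun i j => s.sup fun m => c m * M m i j) v = s.sup fun m => c m • maxVec (M m) v := by
  funext i
  rw [maxVec_eq_sup (fun i j => s.sup fun m => c m * M m i j)]
  simp only [maxVec_eq_sup, Finset.sup_apply, Pi.smul_apply, smul_eq_mul, NNReal.mul_finset_sup,
    NNReal.finset_sup_mul, mul_assoc]
  rw [Finset.sup_comm]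

variable [DecidableEq n]

theorem maxVec_one (v : n → ℝ≥0) : maxVec 1 v = v := by
  funext i
  rw [maxVec_eq_sup]
  refine le_antisymm (Finset.sup_le fun j _ => ?_) ?_
  · by_cases h : i = j
    · subst h
      simp
    · simp [Matrix.one_apply_ne h]
  · simpa using Finset.le_sup (f := fun j => (1 : Matrix n n ℝ≥0) i j * v j) (Finset.mem_univ i)

theorem maxVec_maxPow (M : Matrix n n ℝ≥0) (k : ℕ) (v : n → ℝ≥0) :
    maxVec (maxPow M k) v = (maxVec M)^[k] v := by
  induction k with
  | zero => exact maxVec_one v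
  | succ k ih => rw [maxPow, maxVec_maxMul_s5, ih, Function.iterate_succ_apply']

theorem commute_maxVec_maxPow {f : (n → ℝ≥0) → (n → ℝ≥0)} {M : Matrix n n ℝ≥0}
    (h : Function.Commute f (maxVec M)) (k : ℕ) : Function.Commute f (maxVec (maxPow M k)) := by
  have := h.iterate_right k
  rwa [← funext (maxVec_maxPow M k)] at this

theorem commute_maxVec_maxProdList {f : (n → ℝ≥0) → (n → ℝ≥0)} {l : List (Matrix n n ℝ≥0)}
    (h : ∀ M ∈ l, Function.Commute f (maxVec M)) :
    Function.Commute f (maxVec (maxProdList l)) := by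
  induction l with
  | nil => exact fun v => by simp [maxProdList, maxVec_one]
  | cons M l ih =>
    intro v
    have h1 := h M List.mem_cons_self
    have h2 := ih fun N hN => h N (List.mem_cons_of_mem _ hN)
    change f (maxVec (maxMul M (maxProdList l)) v) = maxVec (maxMul M (maxProdList l)) (f v)
    rw [maxVec_maxMul_s5, maxVec_maxMul_s5, h1.eq, h2.eq]

theorem maxVec_maxPow_of_eigenvector {M : Matrix n n ℝ≥0} {v : n → ℝ≥0} {a : ℝ≥0}
    (h : maxVec M v = a • v) (k : ℕ) : maxVec (maxPow M k) v = a ^ k • v := by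
  induction k with
  | zero => simp [maxPow, maxVec_one]
  | succ k ih =>
    rw [maxPow, maxVec_maxMul_s5, ih, (isMaxLinear_maxVec_s5 M).map_smul, h, smul_smul, pow_succ]

theorem maxVec_maxProdList_ofFn {r : ℕ} {M : Fin r → Matrix n n ℝ≥0} {v : n → ℝ≥0}
    {a : Fin r → ℝ≥0} (h : ∀ k, maxVec (M k) v = a k • v) :
    maxVec (maxProdList (List.ofFn M)) v = (∏ k, a k) • v := by
  induction r with
  | zero => simp [maxProdList, maxVec_one]
  | succ r ih =>
    have ih := ih fun k => h k.succ
    rw [List.ofFn_succ, Fin.prod_univ_succ]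
    change maxVec (maxMul (M 0) (maxProdList _)) v = _
    rw [maxVec_maxMul_s5, ih, (isMaxLinear_maxVec_s5 _).map_smul, h, smul_smul, mul_comm]

end MaxAction

theorem eigenvalues_of_max_polynomial {n : Type*} [Fintype n] [DecidableEq n]
    {r : ℕ} (A : Fin r → Matrix n n ℝ≥0)
    (hcomm : ∀ i j : Fin r, maxMul (A i) (A j) = maxMul (A j) (A i))
    {ι : Type*} (s : Finset ι) (c : ι → ℝ≥0) (e : ι → Fin r → ℕ)
    -- the max polynomial applied to the matrices `A 0, …, A (r-1)`:
    (pA : Matrix n n ℝ≥0)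
    (hpA : pA = fun i j =>
      s.sup fun m => c m * maxProdList (List.ofFn fun k => maxPow (A k) (e m k)) i j)
    -- the max polynomial applied to scalars:
    (pval : (Fin r → ℝ≥0) → ℝ≥0)
    (hpval : pval = fun α => s.sup fun m => c m * ∏ j, α j ^ e m j) :
    (∀ (i₀ : Fin r) (α₀ : ℝ≥0), IsMaxEig (A i₀) α₀ →
      ∃ α : Fin r → ℝ≥0, α i₀ = α₀ ∧ (∀ j, IsMaxEig (A j) (α j)) ∧
        IsMaxEig pA (pval α)) ∧
    (∀ lam : ℝ≥0, IsMaxEig pA lam →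
      ∃ α : Fin r → ℝ≥0, (∀ j, IsMaxEig (A j) (α j)) ∧ lam = pval α) := by
  have hA : ∀ k, IsMaxLinear_s5 (maxVec (A k)) := fun k => isMaxLinear_maxVec_s5 (A k)
  have hAA : ∀ k l v, maxVec (A k) (maxVec (A l) v) = maxVec (A l) (maxVec (A k) v) := by
    intro k l v
    rw [← maxVec_maxMul_s5, hcomm, maxVec_maxMul_s5]
  have hApA : ∀ k v, maxVec (A k) (maxVec pA v) = maxVec pA (maxVec (A k) v) := by
    intro k v
    have h : ∀ m, Function.Commute (maxVec (A k))
        (maxVec (maxProdList (List.ofFn fun l => maxPow (A l) (e m l)))) := fun m =>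
      commute_maxVec_maxProdList fun M hM => by
        obtain ⟨l, rfl⟩ := (List.mem_ofFn' _ _).1 hM
        exact commute_maxVec_maxPow (hAA k l) _
    rw [hpA, maxVec_finset_sup, maxVec_finset_sup,
      Finset.apply_sup_eq_sup_comp _ (hA k).map_sup (hA k).map_zero]
    refine Finset.sup_congr rfl fun m _ => ?_
    rw [Function.comp_apply, (hA k).map_smul, (h m).eq]
  have hpv : ∀ (α : Fin r → ℝ≥0) (v : n → ℝ≥0), (∀ k, maxVec (A k) v = α k • v) →
      maxVec pA v = pval α • v := by
    intro α v h
    rw [hpA, hpval, maxVec_finset_sup]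
    ext i
    simp only [Finset.sup_apply, Pi.smul_apply, smul_eq_mul, NNReal.finset_sup_mul,
      maxVec_maxProdList_ofFn fun k => maxVec_maxPow_of_eigenvector (h k) _, mul_assoc]
  have hcommon : ∀ (M : Matrix n n ℝ≥0) (a : ℝ≥0),
      (∀ k v, maxVec (A k) (maxVec M v) = maxVec M (maxVec (A k) v)) → IsMaxEig M a →
      ∃ (α : Fin r → ℝ≥0) (v : n → ℝ≥0), v ≠ 0 ∧ maxVec M v = a • v ∧
        ∀ k, maxVec (A k) v = α k • v := by
    rintro M a hM ⟨v, hv0, hv⟩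
    obtain ⟨w, hw, hw0, hwA⟩ := IsMaxLinear_s5.exists_common_eigenvector hA hAA Finset.univ
      ((isMaxLinear_maxVec_s5 M).isClosedMaxCone_eigenspace a)
      (fun k x hx => by
        rw [Set.mem_ofPred_eq] at hx ⊢
        rw [← hM, hx, (hA k).map_smul]) ⟨v, hv, hv0⟩
    choose α hα using fun k => hwA k (Finset.mem_univ k)
    exact ⟨α, w, hw0, hw, hα⟩
  have hunique : ∀ (a b : ℝ≥0) (v : n → ℝ≥0), v ≠ 0 → a • v = b • v → a = b := by
    intro a b v hv0 h
    obtain ⟨i, hi⟩ := Function.ne_iff.1 hv0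
    exact mul_right_cancel₀ hi (congrFun h i)
  refine ⟨fun i₀ α₀ h₀ => ?_, fun lam hlam => ?_⟩
  · obtain ⟨α, v, hv0, hv, hα⟩ := hcommon (A i₀) α₀ (fun k => hAA k i₀) h₀
    exact ⟨α, hunique _ _ v hv0 ((hα i₀).symm.trans hv), fun j => ⟨v, hv0, hα j⟩,
      v, hv0, hpv α v hα⟩
  · obtain ⟨α, v, hv0, hv, hα⟩ := hcommon pA lam hApA hlam
    exact ⟨α, fun j => ⟨v, hv0, hα j⟩, hunique _ _ v hv0 (hv.symm.trans (hpv α v hα))⟩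
end

section
/- Let A : Matrix n n ℝ≥0, C : Matrix m m ℝ≥0 and X : Matrix n m ℝ≥0 (n, m finite) satisfy A ⊗ X = X ⊗ C under the max-product, where every column of X is nonzero (for every j : m there exists i : n with X i j ≠ 0). Then every eigenvalue of C is an eigenvalue of A: if there exists z : m → ℝ≥0 with z ≠ 0 and C ⊗ z = μ • z, then there exists u : n → ℝ≥0 with u ≠ 0 and A ⊗ u = μ • u. -/
open scoped NNReal

theorem NNReal.iSup_comm_of_finite {ι κ : Type*} [Finite ι] [Finite κ] (f : ι → κ → ℝ≥0) :
    ⨆ i, ⨆ j, f i j = ⨆ j, ⨆ i, f i j := by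
  refine eq_of_forall_ge_iff fun c => ?_
  simp only [ciSup_le_iff' (Set.finite_range _).bddAbove]
  exact forall_comm

theorem maxVec_ne_zero {l m : Type*} [Fintype m] (A : Matrix l m ℝ≥0)
    (hA : ∀ j, ∃ i, A i j ≠ 0) {v : m → ℝ≥0} (hv : v ≠ 0) : maxVec A v ≠ 0 := by
  obtain ⟨j, hj⟩ := Function.ne_iff.mp hv
  obtain ⟨i, hi⟩ := hA j
  have hle : A i j * v j ≤ maxVec A v i :=
    le_ciSup (f := fun j => A i j * v j) (Set.finite_range _).bddAbove j
  exact Function.ne_iff.mpr ⟨i, ((pos_iff_ne_zero.mpr (mul_ne_zero hi hj)).trans_le hle).ne'⟩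

theorem eigenvalue_transfer_of_intertwiner {n m : Type*} [Fintype n] [Fintype m]
    (A : Matrix n n ℝ≥0) (C : Matrix m m ℝ≥0) (X : Matrix n m ℝ≥0)
    (hAX : maxMul A X = maxMul X C)
    (hcol : ∀ j : m, ∃ i : n, X i j ≠ 0)
    (μ : ℝ≥0) (hμ : ∃ z : m → ℝ≥0, z ≠ 0 ∧ maxVec C z = μ • z) :
    ∃ u : n → ℝ≥0, u ≠ 0 ∧ maxVec A u = μ • u := by
  obtain ⟨z, hz, hCz⟩ := hμ
  refine ⟨maxVec X z, maxVec_ne_zero X hcol hz, ?_⟩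
  rw [← maxVec_maxMul, hAX, maxVec_maxMul, hCz, maxVec_smul]
end

section
/- Let A : Matrix n n ℝ≥0 and C : Matrix m m ℝ≥0 be irreducible (n, m finite) and let X : Matrix n m ℝ≥0 be nonzero with A ⊗ X = X ⊗ C under the max-product. Then the Perron roots of A and C coincide: every eigenvalue of A equals every eigenvalue of C, i.e. if A ⊗ v = α • v with v ≠ 0 and C ⊗ z = γ • z with z ≠ 0, then α = γ. -/
open scoped NNReal

/-- A matrix over ℝ≥0 is irreducible if its positivity digraph is strongly connected. -/
def MaxIrreducible {n : Type*} (A : Matrix n n ℝ≥0) : Prop :=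
  ∀ i j : n, i ≠ j → Relation.TransGen (fun a b => 0 < A a b) i j

theorem maxVec_le_iff {l m : Type*} [Fintype m] (A : Matrix l m ℝ≥0) (v : m → ℝ≥0) (i : l)
    (b : ℝ≥0) : maxVec A v i ≤ b ↔ ∀ j, A i j * v j ≤ b :=
  ciSup_le_iff' (Set.finite_range _).bddAbove

theorem mul_le_maxVec {l m : Type*} [Fintype m] (A : Matrix l m ℝ≥0) (v : m → ℝ≥0) (i : l)
    (j : m) : A i j * v j ≤ maxVec A v i :=
  (maxVec_le_iff A v i _).1 le_rfl j

/-- Eigenvectors of an irreducible matrix have full support. -/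
theorem MaxIrreducible.pos_of_maxVec_eq_smul {n : Type*} [Fintype n] {A : Matrix n n ℝ≥0}
    (hA : MaxIrreducible A) {α : ℝ≥0} {v : n → ℝ≥0} (hv : v ≠ 0) (h : maxVec A v = α • v)
    (i : n) : 0 < v i := by
  obtain ⟨j, hj⟩ := Function.ne_iff.1 hv
  have hj : 0 < v j := pos_iff_ne_zero.2 hj
  have step (a b : n) (hab : 0 < A a b) (hb : 0 < v b) : 0 < v a := by
    have hpos := (mul_pos hab hb).trans_le (mul_le_maxVec A v a b)
    rw [h] at hpos
    exact pos_of_mul_pos_right hpos zero_le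
  by_cases hij : i = j
  · exact hij ▸ hj
  · have hpath := hA i j hij
    clear hij
    induction hpath using Relation.TransGen.head_induction_on with
    | single hab => exact step _ _ hab hj
    | head hab _ ih => exact step _ _ hab ih

/-- A positive eigenvector of a max-algebraic matrix belongs to its largest eigenvalue. -/
theorem le_of_maxVec_eq_smul {n : Type*} [Fintype n] {A : Matrix n n ℝ≥0} {α β : ℝ≥0}
    {v w : n → ℝ≥0} (hv : ∀ i, 0 < v i) (hw : w ≠ 0) (hα : maxVec A v = α • v)
    (hβ : maxVec A w = β • w) : β ≤ α := by
  obtain ⟨j, hj⟩ := Function.ne_iff.1 hw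
  have : Nonempty n := ⟨j⟩
  obtain ⟨i, hi⟩ := Finite.exists_max fun i => w i / v i
  have hwi : 0 < w i := by
    have := (div_pos (pos_iff_ne_zero.2 hj) (hv j)).trans_le (hi j)
    exact pos_iff_ne_zero.2 fun h => by simp [h] at this
  have hle : maxVec A w i ≤ maxVec A ((w i / v i) • v) i :=
    (maxVec_le_iff _ _ _ _).2 fun k =>
      (mul_le_mul_right ((div_le_iff₀ (hv k)).1 (hi k)) (A i k)).trans
        (mul_le_maxVec A ((w i / v i) • v) i k)
  rw [maxVec_smul, hα, hβ] at hle
  simp only [Pi.smul_apply, smul_eq_mul] at hle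
  rw [mul_left_comm, div_mul_cancel₀ _ (hv i).ne'] at hle
  exact le_of_mul_le_mul_right hle hwi

theorem perron_roots_eq_of_nonzero_intertwiner {n m : Type*} [Fintype n] [Fintype m]
    (A : Matrix n n ℝ≥0) (C : Matrix m m ℝ≥0) (X : Matrix n m ℝ≥0)
    (hA : MaxIrreducible A) (hC : MaxIrreducible C)
    (hX : X ≠ 0) (hAX : maxMul A X = maxMul X C)
    (α γ : ℝ≥0)
    (hα : ∃ v : n → ℝ≥0, v ≠ 0 ∧ maxVec A v = α • v)
    (hγ : ∃ z : m → ℝ≥0, z ≠ 0 ∧ maxVec C z = γ • z) :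
    α = γ := by
  obtain ⟨v, hv, hα⟩ := hα
  obtain ⟨z, hz, hγ⟩ := hγ
  have hw : maxVec X z ≠ 0 := by
    contrapose! hX
    ext i j
    have hle := mul_le_maxVec X z i j
    rw [hX] at hle
    simpa [(hC.pos_of_maxVec_eq_smul hz hγ j).ne'] using hle
  have hAw : maxVec A (maxVec X z) = γ • maxVec X z := by
    rw [← maxVec_maxMul, hAX, maxVec_maxMul, hγ, maxVec_smul]
  exact le_antisymm
    (le_of_maxVec_eq_smul (hA.pos_of_maxVec_eq_smul hw hAw) hv hAw hα)
    (le_of_maxVec_eq_smul (hA.pos_of_maxVec_eq_smul hv hα) hw hα hAw)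
end

section
/- Let A : Fin r → Matrix n n ℝ≥0 (n finite, r ≥ 1) commute in pairs under the max-product, and assume each matrix A k has distinct class Perron roots. Let S be the entrywise maximum, S i j = ⨆ k, A k i j. Then the access relations of all the matrices A k and of S coincide: for all k, k' : Fin r and all nodes i, j, node i has access to j in A k if and only if i has access to j in A k', if and only if i has access to j in S. (Consequently the classes of all the A k and of S coincide, and the transitive closures of their reduced digraphs coincide.) -/
open scoped NNReal

/-- Node `i` has access to node `j` in the positivity digraph of `M`. -/
def HasAccess {n : Type*} (M : Matrix n n ℝ≥0) (i j : n) : Prop :=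
  Relation.ReflTransGen (fun a b => 0 < M a b) i j

/-- `i` and `j` are in the same class of `M` (mutual access). -/
def SameClass {n : Type*} (M : Matrix n n ℝ≥0) (i j : n) : Prop :=
  HasAccess M i j ∧ HasAccess M j i

/-- A nonempty list of nodes is a cycle of `M` if all consecutive edges,
including the wrap-around edge from the last node to the head, are positive. -/
def IsCycle {n : Type*} (M : Matrix n n ℝ≥0) (l : List n) : Prop :=
  l ≠ [] ∧ ∀ p ∈ l.zip (l.rotate 1), 0 < M p.1 p.2

/-- The product of the entries of `M` along a cycle (with wrap-around edge). -/
noncomputable def cycleWeight {n : Type*} (M : Matrix n n ℝ≥0) (l : List n) : ℝ≥0 :=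
  ((l.zip (l.rotate 1)).map fun p => M p.1 p.2).prod

/-- The Perron root of the class of node `i` in `M`: the supremum of the geometric
means of cycles of `M` all of whose nodes lie in the class of `i`. -/
noncomputable def classPerronRoot {n : Type*} (M : Matrix n n ℝ≥0) (i : n) : ℝ≥0 :=
  sSup {w : ℝ≥0 | ∃ l : List n, IsCycle M l ∧ (∀ x ∈ l, SameClass M i x) ∧
    w = cycleWeight M l ^ ((1 : ℝ) / l.length)}

/-- `M` has distinct class Perron roots. -/
def DistinctClassRoots {n : Type*} (M : Matrix n n ℝ≥0) : Prop :=
  ∀ i j : n, ¬ SameClass M i j → classPerronRoot M i ≠ classPerronRoot M j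

theorem List.getLastD_append_eq {α : Type*} (x : α) (w v : List α) :
    (w ++ v).getLastD x = v.getLastD (w.getLastD x) := by
  induction w generalizing x with
  | nil => rfl
  | cons y w ih => rw [List.cons_append, List.getLastD_cons, List.getLastD_cons, ih]

/-- The weight of the walk in `M` that starts at `x` and then visits the nodes of the list. -/
noncomputable def walkWeight {n : Type*} (M : Matrix n n ℝ≥0) : n → List n → ℝ≥0
  | _, [] => 1
  | x, y :: w => M x y * walkWeight M y w

section Walks

variable {n : Type*} {M : Matrix n n ℝ≥0}

theorem walkWeight_append (x : n) (w v : List n) :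
    walkWeight M x (w ++ v) = walkWeight M x w * walkWeight M (w.getLastD x) v := by
  induction w generalizing x with
  | nil => simp [walkWeight]
  | cons y w ih =>
    rw [List.cons_append, walkWeight, walkWeight, ih, List.getLastD_cons, mul_assoc]

theorem prod_zip_eq_walkWeight (x z : n) (l : List n) :
    (((x :: l).zip (l ++ [z])).map fun p => M p.1 p.2).prod = walkWeight M x (l ++ [z]) := by
  induction l generalizing x with
  | nil => simp [walkWeight]
  | cons y l ih => simpa [walkWeight] using Or.inl (ih y)

theorem cycleWeight_cons (x : n) (l : List n) :
    cycleWeight M (x :: l) = walkWeight M x (l ++ [x]) := by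
  simpa [cycleWeight] using prod_zip_eq_walkWeight (M := M) x x l

theorem isCycle_cons (x : n) (l : List n) :
    IsCycle M (x :: l) ↔ 0 < walkWeight M x (l ++ [x]) := by
  rw [← cycleWeight_cons, cycleWeight, pos_iff_ne_zero, Ne, List.prod_eq_zero_iff]
  simp only [IsCycle, ne_eq, reduceCtorEq, not_false_eq_true, true_and, List.mem_map, not_exists,
    not_and, pos_iff_ne_zero]

theorem hasAccess_of_mem_walk {x : n} {w : List n} (h : 0 < walkWeight M x w) :
    ∀ y ∈ x :: w, HasAccess M x y ∧ HasAccess M y (w.getLastD x) := by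
  induction w generalizing x with
  | nil =>
    intro y hy
    obtain rfl : y = x := by simpa using hy
    exact ⟨.refl, .refl⟩
  | cons z w ih =>
    obtain ⟨h1, h2⟩ := CanonicallyOrderedAdd.mul_pos.1 h
    have h3 := ih h2
    intro y hy
    rw [List.getLastD_cons]
    rcases List.mem_cons.1 hy with rfl | hy
    · exact ⟨.refl, .head h1 (h3 z (by simp)).2⟩
    · exact ⟨.head h1 (h3 y hy).1, (h3 y hy).2⟩

theorem HasAccess.exists_walk {x z : n} (h : HasAccess M x z) :
    ∃ w : List n, w.getLastD x = z ∧ 0 < walkWeight M x w := by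
  induction h using Relation.ReflTransGen.head_induction_on with
  | refl => exact ⟨[], rfl, by simp [walkWeight]⟩
  | @head a b hab _ ih =>
    obtain ⟨w, hw, hpos⟩ := ih
    exact ⟨b :: w, by rw [List.getLastD_cons, hw], mul_pos hab hpos⟩

/-- Repeating a closed walk raises its weight to a power. -/
theorem exists_walk_pow (x : n) (v : List n) (hv : v.getLastD x = x) (t : ℕ) :
    ∃ u : List n, u.getLastD x = x ∧ u.length = t * v.length ∧
      walkWeight M x u = walkWeight M x v ^ t := by
  induction t with
  | zero => exact ⟨[], rfl, by simp, by simp [walkWeight]⟩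
  | succ t ih =>
    obtain ⟨u, hu, hlen, hw⟩ := ih
    exact ⟨u ++ v, by rw [List.getLastD_append_eq, hu, hv], by simp [hlen, Nat.succ_mul],
      by rw [walkWeight_append, hu, hw, pow_succ]⟩

theorem walkWeight_le_pow {b : ℝ≥0} (hb : ∀ x y, M x y ≤ b) (x : n) (w : List n) :
    walkWeight M x w ≤ b ^ w.length := by
  induction w generalizing x with
  | nil => simp [walkWeight]
  | cons y w ih =>
    rw [walkWeight, List.length_cons, pow_succ']
    exact mul_le_mul' (hb x y) (ih y)

/-- A closed walk can be cut out of any walk that visits some node twice. -/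
theorem exists_closed_subwalk (x : n) (w : List n) (h : ¬ (x :: w).Nodup) :
    ∃ (z : n) (l w' : List n), z ∈ x :: w ∧ w' ⊆ w ∧ w.length = w'.length + (l.length + 1) ∧
      walkWeight M x w = walkWeight M z (l ++ [z]) * walkWeight M x w' := by
  induction w generalizing x with
  | nil => simp at h
  | cons b v ih =>
    by_cases hx : x ∈ b :: v
    · obtain ⟨l, w', hs⟩ := List.append_of_mem hx
      refine ⟨x, l, w', by simp, by simp [hs], by simp [hs]; omega, ?_⟩
      rw [hs, List.append_cons, walkWeight_append]
      simp
    · obtain ⟨z, l, w', hz, hsub, hlen, hw⟩ := ih b fun hn => h (List.nodup_cons.2 ⟨hx, hn⟩)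
      refine ⟨z, l, b :: w', List.mem_cons_of_mem _ hz, List.cons_subset_cons _ hsub,
        by simp [hlen]; omega, ?_⟩
      rw [walkWeight, walkWeight, hw, mul_left_comm]

theorem exists_entry_bound [Finite n] (M : Matrix n n ℝ≥0) :
    ∃ b : ℝ≥0, 1 ≤ b ∧ ∀ x y, M x y ≤ b := by
  obtain ⟨b, hb⟩ := (Set.finite_range fun p : n × n => M p.1 p.2).bddAbove
  exact ⟨max 1 b, le_max_left _ _, fun x y => le_max_of_le_right (hb ⟨(x, y), rfl⟩)⟩

theorem exists_closed_walk_of_lt {μ : ℝ≥0} {c : n} (h : μ < classPerronRoot M c) :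
    ∃ (z : n) (l : List n), SameClass M c z ∧ μ ^ (l.length + 1) < walkWeight M z (l ++ [z]) := by
  have hne : {w : ℝ≥0 | ∃ l : List n, IsCycle M l ∧ (∀ x ∈ l, SameClass M c x) ∧
      w = cycleWeight M l ^ ((1 : ℝ) / l.length)}.Nonempty := by
    by_contra hempty
    rw [classPerronRoot, Set.not_nonempty_iff_eq_empty.1 hempty] at h
    simp at h
  obtain ⟨_, ⟨_ | ⟨z, l⟩, hcyc, hcl, rfl⟩, hlt⟩ := exists_lt_of_lt_csSup hne h
  · exact absurd rfl hcyc.1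
  · refine ⟨z, l, hcl z (by simp), ?_⟩
    rwa [cycleWeight_cons, one_div, NNReal.lt_rpow_inv_iff (by simp; positivity),
      NNReal.rpow_natCast] at hlt

end Walks

section PerronRoot

variable {n : Type*} [Finite n] {M : Matrix n n ℝ≥0}

theorem walkWeight_closed_le (x : n) (l : List n) :
    walkWeight M x (l ++ [x]) ≤ classPerronRoot M x ^ (l.length + 1) := by
  rcases eq_zero_or_pos (walkWeight M x (l ++ [x])) with h0 | hpos
  · simp [h0]
  obtain ⟨b, -, hb⟩ := exists_entry_bound M
  have hroot : walkWeight M x (l ++ [x]) ^ ((1 : ℝ) / (l.length + 1 : ℕ)) ≤ classPerronRoot M x := by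
    refine le_csSup ⟨b, ?_⟩ ⟨x :: l, (isCycle_cons x l).2 hpos, fun y hy => ?_, ?_⟩
    · rintro _ ⟨_ | ⟨y, v⟩, hcyc, -, rfl⟩
      · exact absurd rfl hcyc.1
      · rw [cycleWeight_cons, one_div, NNReal.rpow_inv_le_iff (by simp; positivity),
          NNReal.rpow_natCast]
        simpa using walkWeight_le_pow hb y (v ++ [y])
    · have := hasAccess_of_mem_walk hpos y (by
        rcases List.mem_cons.1 hy with rfl | hy <;> simp [*])
      simpa [SameClass] using this
    · rw [cycleWeight_cons, List.length_cons]
  rwa [one_div, NNReal.rpow_inv_le_iff (by positivity), NNReal.rpow_natCast] at hroot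

/-- Walks through classes of Perron root at most `μ` have weight `O(μ ^ length)`. -/
theorem exists_walkWeight_le {μ : ℝ≥0} (hμ : 0 < μ) :
    ∃ K : ℝ≥0, ∀ (x : n) (w : List n), (∀ y ∈ x :: w, classPerronRoot M y ≤ μ) →
      walkWeight M x w ≤ K * μ ^ w.length := by
  have := Fintype.ofFinite n
  obtain ⟨b, -, hb⟩ := exists_entry_bound M
  refine ⟨max 1 (b / μ) ^ Fintype.card n, fun x w => ?_⟩
  induction hN : w.length using Nat.strong_induction_on generalizing w with
  | _ N ih =>
  intro hroot
  by_cases hnd : (x :: w).Nodup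
  · have hcard : N ≤ Fintype.card n := by
      have := hnd.length_le_card
      simp only [List.length_cons] at this
      omega
    calc walkWeight M x w ≤ b ^ N := hN ▸ walkWeight_le_pow hb x w
      _ = (b / μ) ^ N * μ ^ N := by rw [← mul_pow, div_mul_cancel₀ _ hμ.ne']
      _ ≤ max 1 (b / μ) ^ N * μ ^ N := by gcongr; exact le_max_right _ _
      _ ≤ max 1 (b / μ) ^ Fintype.card n * μ ^ N := by
        gcongr
        exact le_max_left _ _
  · obtain ⟨z, l, w', hz, hsub, hlen, hw⟩ := exists_closed_subwalk (M := M) x w hnd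
    have h1 := ih w'.length (by omega) w' rfl fun y hy =>
      hroot y (List.cons_subset_cons x hsub hy)
    have h2 : walkWeight M z (l ++ [z]) ≤ μ ^ (l.length + 1) :=
      (walkWeight_closed_le z l).trans (pow_le_pow_left' (hroot z hz) _)
    calc walkWeight M x w = walkWeight M z (l ++ [z]) * walkWeight M x w' := hw
      _ ≤ μ ^ (l.length + 1) * (max 1 (b / μ) ^ Fintype.card n * μ ^ w'.length) :=
        mul_le_mul' h2 h1
      _ = max 1 (b / μ) ^ Fintype.card n * μ ^ N := by rw [← hN, hlen]; ring

/-- Walks whose weights grow faster than the powers of `μ` must meet a class of Perron root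
greater than `μ`. -/
theorem not_forall_exists_fast_walk {μ p a : ℝ≥0} {L m : ℕ} (hμ : 0 < μ) (hp : μ ^ L < p)
    (ha : 0 < a) :
    ¬ ∀ t : ℕ, ∃ (x : n) (w : List n), w.length = m + t * L ∧
      (∀ y ∈ x :: w, classPerronRoot M y ≤ μ) ∧ a * p ^ t ≤ walkWeight M x w := by
  intro h
  obtain ⟨K, hK⟩ := exists_walkWeight_le (M := M) hμ
  have hq : 0 < μ ^ L := pow_pos hμ L
  obtain ⟨t, ht⟩ := pow_unbounded_of_one_lt (K * μ ^ m / a) ((one_lt_div hq).2 hp)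
  obtain ⟨x, w, hlen, hroot, hle⟩ := h t
  have h1 := hle.trans (hK x w hroot)
  rw [div_pow, div_lt_div_iff₀ ha (pow_pos hq t)] at ht
  rw [hlen, pow_add, mul_comm t L, pow_mul, ← mul_assoc, mul_comm a] at h1
  exact absurd h1 (not_le.2 ht)

/-- If the class of `c` has the largest Perron root among the classes meeting `Q` and is not the
only one of them, its Perron root is separated by some positive `μ` from those of the others. -/
theorem DistinctClassRoots.exists_separation (hM : DistinctClassRoots M) {Q : Set n} {c x : n}
    (hmax : ∀ y ∈ Q, classPerronRoot M y ≤ classPerronRoot M c) (hx : x ∈ Q)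
    (hxc : ¬ SameClass M c x) :
    ∃ μ : ℝ≥0, 0 < μ ∧ (∀ y ∈ Q, ¬ SameClass M c y → classPerronRoot M y ≤ μ) ∧
      ∃ (z : n) (l : List n), SameClass M c z ∧
        μ ^ (l.length + 1) < walkWeight M z (l ++ [z]) := by
  obtain ⟨y, ⟨hyQ, hyc⟩, hy⟩ := Set.exists_max_image {y | y ∈ Q ∧ ¬ SameClass M c y}
    (classPerronRoot M) (Set.toFinite _) ⟨x, hx, hxc⟩
  obtain ⟨μ, hyμ, hμc⟩ := exists_between (lt_of_le_of_ne (hmax y hyQ) (hM c y hyc).symm)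
  exact ⟨μ, pos_of_gt hyμ, fun u hu huc => (hy u ⟨hu, huc⟩).trans hyμ.le,
    exists_closed_walk_of_lt hμc⟩

end PerronRoot

section Commuting

variable {n : Type*} {A B : Matrix n n ℝ≥0}

theorem exists_mul_le_of_maxMul_eq [Fintype n] (h : maxMul A B = maxMul B A) (x y z : n) :
    ∃ u, A x y * B y z ≤ B x u * A u z := by
  have : Nonempty n := ⟨x⟩
  obtain ⟨u, hu⟩ := exists_eq_ciSup_of_finite (f := fun u => B x u * A u z)
  exact ⟨u, (le_ciSup (f := fun y => A x y * B y z) (Set.finite_range _).bddAbove y).trans_eq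
    ((congrFun (congrFun h x) z).trans hu.symm)⟩

/-- An edge of `B` can be moved from the start of a walk of `A` to its end. -/
theorem exists_walk_move_right (h : ∀ x y z, ∃ u, B x y * A y z ≤ A x u * B u z) (x y : n)
    (w : List n) : ∃ w' : List n, w'.length = w.length ∧
      B x y * walkWeight A y w ≤ walkWeight A x w' * B (w'.getLastD x) (w.getLastD y) := by
  induction w generalizing x y with
  | nil => exact ⟨[], rfl, by simp [walkWeight]⟩
  | cons v w ih =>
    obtain ⟨u, hu⟩ := h x y v
    obtain ⟨w', hlen, hw⟩ := ih u v
    refine ⟨u :: w', by simp [hlen], ?_⟩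
    simp only [walkWeight, List.getLastD_cons]
    calc B x y * (A y v * walkWeight A v w) = B x y * A y v * walkWeight A v w := by ring
      _ ≤ A x u * B u v * walkWeight A v w := by gcongr
      _ = A x u * (B u v * walkWeight A v w) := by ring
      _ ≤ A x u * (walkWeight A u w' * B (w'.getLastD u) (w.getLastD v)) := by gcongr
      _ = _ := by ring

/-- An edge of `B` can be moved from the end of a walk of `A` to its start. -/
theorem exists_walk_move_left (h : ∀ x y z, ∃ u, A x y * B y z ≤ B x u * A u z) (y z : n)
    (w : List n) : ∃ (u : n) (w' : List n), w'.length = w.length ∧ w'.getLastD u = z ∧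
      walkWeight A y w * B (w.getLastD y) z ≤ B y u * walkWeight A u w' := by
  induction w generalizing y with
  | nil => exact ⟨z, [], rfl, rfl, by simp [walkWeight]⟩
  | cons v w ih =>
    obtain ⟨v', w', hlen, hlast, hw⟩ := ih v
    obtain ⟨u, hu⟩ := h y v v'
    refine ⟨u, v' :: w', by simp [hlen], by rw [List.getLastD_cons, hlast], ?_⟩
    simp only [walkWeight, List.getLastD_cons]
    calc A y v * walkWeight A v w * B (w.getLastD v) z
        = A y v * (walkWeight A v w * B (w.getLastD v) z) := by ring
      _ ≤ A y v * (B v v' * walkWeight A v' w') := by gcongr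
      _ = A y v * B v v' * walkWeight A v' w' := by ring
      _ ≤ B y u * A u v' * walkWeight A v' w' := by gcongr
      _ = _ := by ring

/-- Access in the union of the positivity digraphs of `A` and `B`. -/
def JointAccess {n : Type*} (A B : Matrix n n ℝ≥0) (i j : n) : Prop :=
  Relation.ReflTransGen (fun a b => 0 < A a b ∨ 0 < B a b) i j

theorem HasAccess.jointAccess {i j : n} (h : HasAccess A i j) : JointAccess A B i j :=
  Relation.ReflTransGen.mono (fun _ _ => Or.inl) _ _ h

variable [Finite n] {i j c x y : n}

/-- Relative to the nodes between `i` and `j`, the nodes with access in `A` to a class of largest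
Perron root are closed under predecessors in `B`. -/
theorem hasAccess_of_edge_left (h : ∀ x y z, ∃ u, B x y * A y z ≤ A x u * B u z)
    (hA : DistinctClassRoots A)
    (hmax : ∀ y, JointAccess A B i y → JointAccess A B y j →
      classPerronRoot A y ≤ classPerronRoot A c)
    (hix : JointAccess A B i x) (hcj : JointAccess A B c j) (hxy : 0 < B x y)
    (hyc : HasAccess A y c) : HasAccess A x c := by
  by_contra hxc
  have hxj : JointAccess A B x j := .head (Or.inr hxy) (hyc.jointAccess.trans hcj)
  obtain ⟨μ, hμ, hle, z, l, hcz, hlt⟩ := hA.exists_separation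
    (Q := {y | JointAccess A B i y ∧ JointAccess A B y j}) (fun y hy => hmax y hy.1 hy.2)
    ⟨hix, hxj⟩ (fun hs => hxc hs.2)
  obtain ⟨w, hwz, hw⟩ := HasAccess.exists_walk (hyc.trans hcz.1)
  obtain ⟨b, hb1, hb⟩ := exists_entry_bound B
  have hb0 : 0 < b := one_pos.trans_le hb1
  refine not_forall_exists_fast_walk (M := A) (m := w.length) (L := l.length + 1) hμ hlt
    (a := B x y * walkWeight A y w / b) (by positivity) fun t => ?_
  obtain ⟨v, hvz, hvlen, hv⟩ := exists_walk_pow (M := A) z (l ++ [z]) (by simp) t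
  obtain ⟨w', hlen, hw'⟩ := exists_walk_move_right h x y (w ++ v)
  have hlast : (w ++ v).getLastD y = z := by rw [List.getLastD_append_eq, hwz, hvz]
  rw [hlast, walkWeight_append, hwz, hv] at hw'
  have hpos : 0 < walkWeight A x w' * B (w'.getLastD x) z :=
    lt_of_lt_of_le (mul_pos hxy (mul_pos hw (pow_pos (pos_of_gt hlt) t))) hw'
  obtain ⟨hpos1, hpos2⟩ := CanonicallyOrderedAdd.mul_pos.1 hpos
  refine ⟨x, w', by simpa [hvlen] using hlen, fun u hu => ?_, ?_⟩
  · obtain ⟨hxu, hu'⟩ := hasAccess_of_mem_walk hpos1 u hu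
    exact hle u ⟨hix.trans hxu.jointAccess,
      (hu'.jointAccess.tail (Or.inr hpos2)).trans (hcz.2.jointAccess.trans hcj)⟩
      fun hs => hxc (hxu.trans hs.2)
  · rw [div_mul_eq_mul_div, div_le_iff₀ hb0, mul_assoc]
    exact hw'.trans (mul_le_mul_right (hb _ _) _)

/-- Relative to the nodes between `i` and `j`, the nodes accessed in `A` from a class of largest
Perron root are closed under successors in `B`. -/
theorem hasAccess_of_edge_right (h : ∀ x y z, ∃ u, A x y * B y z ≤ B x u * A u z)
    (hA : DistinctClassRoots A)
    (hmax : ∀ y, JointAccess A B i y → JointAccess A B y j →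
      classPerronRoot A y ≤ classPerronRoot A c)
    (hyj : JointAccess A B y j) (hic : JointAccess A B i c) (hxy : 0 < B x y)
    (hcx : HasAccess A c x) : HasAccess A c y := by
  by_contra hcy
  have hiy : JointAccess A B i y := (hic.trans hcx.jointAccess).tail (Or.inr hxy)
  obtain ⟨μ, hμ, hle, z, l, hcz, hlt⟩ := hA.exists_separation
    (Q := {y | JointAccess A B i y ∧ JointAccess A B y j}) (fun y hy => hmax y hy.1 hy.2)
    ⟨hiy, hyj⟩ (fun hs => hcy hs.1)
  obtain ⟨w, hwx, hw⟩ := HasAccess.exists_walk (hcz.2.trans hcx)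
  obtain ⟨b, hb1, hb⟩ := exists_entry_bound B
  have hb0 : 0 < b := one_pos.trans_le hb1
  refine not_forall_exists_fast_walk (M := A) (m := w.length) (L := l.length + 1) hμ hlt
    (a := walkWeight A z w * B x y / b) (by positivity) fun t => ?_
  obtain ⟨v, hvz, hvlen, hv⟩ := exists_walk_pow (M := A) z (l ++ [z]) (by simp) t
  obtain ⟨u, w', hlen, hlast', hw'⟩ := exists_walk_move_left h z y (v ++ w)
  have hlast : (v ++ w).getLastD z = x := by rw [List.getLastD_append_eq, hvz, hwx]
  rw [hlast, walkWeight_append, hvz, hv] at hw'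
  have hpos : 0 < B z u * walkWeight A u w' :=
    lt_of_lt_of_le (mul_pos (mul_pos (pow_pos (pos_of_gt hlt) t) hw) hxy) hw'
  obtain ⟨hpos1, hpos2⟩ := CanonicallyOrderedAdd.mul_pos.1 hpos
  refine ⟨u, w', by rw [hlen]; simp [hvlen, add_comm], fun s hs => ?_, ?_⟩
  · obtain ⟨hus, hsy⟩ := hasAccess_of_mem_walk hpos2 s hs
    rw [hlast'] at hsy
    exact hle s ⟨((hic.trans hcz.1.jointAccess).tail (Or.inr hpos1)).trans hus.jointAccess,
      hsy.jointAccess.trans hyj⟩ fun hs => hcy (hs.1.trans hsy)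
  · rw [div_mul_eq_mul_div, div_le_iff₀ hb0]
    calc walkWeight A z w * B x y * walkWeight A z (l ++ [z]) ^ t
        = walkWeight A z (l ++ [z]) ^ t * walkWeight A z w * B x y := by ring
      _ ≤ B z u * walkWeight A u w' := hw'
      _ ≤ b * walkWeight A u w' := by gcongr; exact hb _ _
      _ = _ := mul_comm _ _

end Commuting

/-- If `A` has distinct class Perron roots and commutes with `B`, then joint access in `A` and `B`
is already access in `A`. -/
theorem JointAccess.hasAccess {n : Type*} [Fintype n] {A B : Matrix n n ℝ≥0}
    (hcomm : maxMul A B = maxMul B A) (hA : DistinctClassRoots A) {i j : n}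
    (hij : JointAccess A B i j) : HasAccess A i j := by
  obtain ⟨c, ⟨hic, hcj⟩, hc⟩ := Set.exists_max_image
    {y | JointAccess A B i y ∧ JointAccess A B y j} (classPerronRoot A) (Set.toFinite _)
    ⟨i, .refl, hij⟩
  have hmax := fun y h1 h2 => hc y ⟨h1, h2⟩
  have hleft : ∀ x, JointAccess A B x c → JointAccess A B i x → HasAccess A x c := by
    intro x hxc
    induction hxc using Relation.ReflTransGen.head_induction_on with
    | refl => exact fun _ => .refl
    | head hxy _ ih =>
      intro hix
      have hyc := ih (.tail hix hxy)
      rcases hxy with hxy | hxy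
      · exact .head hxy hyc
      · exact hasAccess_of_edge_left (exists_mul_le_of_maxMul_eq hcomm.symm) hA hmax hix hcj
          hxy hyc
  have hright : ∀ y, JointAccess A B c y → JointAccess A B y j → HasAccess A c y := by
    intro y hcy
    induction hcy with
    | refl => exact fun _ => .refl
    | tail _ hxy ih =>
      intro hyj
      have hcx := ih (.head hxy hyj)
      rcases hxy with hxy | hxy
      · exact .tail hcx hxy
      · exact hasAccess_of_edge_right (exists_mul_le_of_maxMul_eq hcomm) hA hmax hyj hic hxy hcx
  exact (hleft i hic .refl).trans (hright j hcj .refl)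

theorem access_relations_coincide {n : Type*} [Fintype n] {r : ℕ} (hr : 1 ≤ r)
    (A : Fin r → Matrix n n ℝ≥0)
    (hcomm : ∀ k k' : Fin r, maxMul (A k) (A k') = maxMul (A k') (A k))
    (hdist : ∀ k : Fin r, DistinctClassRoots (A k))
    (S : Matrix n n ℝ≥0) (hS : S = fun i j => ⨆ k, A k i j) :
    ∀ (k k' : Fin r) (i j : n),
      (HasAccess (A k) i j ↔ HasAccess (A k') i j) ∧
      (HasAccess (A k) i j ↔ HasAccess S i j) := by
  subst hS
  have edge : ∀ k k' i j, 0 < A k' i j → HasAccess (A k) i j := fun k k' i j h =>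
    JointAccess.hasAccess (hcomm k k') (hdist k) (.single (Or.inr h))
  have lift : ∀ k (N : Matrix n n ℝ≥0), (∀ i j, 0 < N i j → HasAccess (A k) i j) →
      ∀ i j, HasAccess N i j → HasAccess (A k) i j := by
    intro k N hN i j h
    induction h with
    | refl => exact .refl
    | tail _ h2 ih => exact ih.trans (hN _ _ h2)
  intro k k' i j
  refine ⟨⟨lift k' _ (edge k' k) i j, lift k _ (edge k k') i j⟩,
    Relation.ReflTransGen.mono (fun a b h => ?_) _ _, lift k _ (fun a b h => ?_) i j⟩
  · exact h.trans_le (le_ciSup (f := fun k => A k a b) (Set.finite_range _).bddAbove k)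
  · have : Nonempty (Fin r) := ⟨k⟩
    obtain ⟨l, hl⟩ := exists_eq_ciSup_of_finite (f := fun k => A k a b)
    exact edge k l a b (h.trans_eq hl.symm)
end

section
/- Let A, B : Matrix n n ℝ≥0 (n finite) have all entries ≤ 1, and for a matrix M with entries ≤ 1 define M^[1] : Matrix n n ℝ≥0 by M^[1] i j = 1 if M i j = 1 and M^[1] i j = 0 otherwise. Then (A ⊗ B)^[1] = A^[1] ⊗ B^[1], where ⊗ is the max-product. -/
open scoped NNReal Classical

/-- The Boolean (0/1) part of a matrix over ℝ≥0: entry `1` where `M i j = 1`, else `0`. -/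
noncomputable def boolPart {n m : Type*} (M : Matrix n m ℝ≥0) : Matrix n m ℝ≥0 :=
  fun i j => if M i j = 1 then 1 else 0

theorem NNReal.mul_eq_one_iff_of_le_one {a b : ℝ≥0} (ha : a ≤ 1) (hb : b ≤ 1) :
    a * b = 1 ↔ a = 1 ∧ b = 1 := by
  refine ⟨fun h => ⟨le_antisymm ha ?_, le_antisymm hb ?_⟩, ?_⟩
  · exact h ▸ mul_le_of_le_one_right' hb
  · exact h ▸ mul_le_of_le_one_left' ha
  · rintro ⟨rfl, rfl⟩
    exact one_mul 1

theorem NNReal.iSup_ite_eq_one {ι : Type*} [Finite ι] [Nonempty ι] {f : ι → ℝ≥0}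
    (hf : ∀ j, f j ≤ 1) :
    (if ⨆ j, f j = 1 then 1 else 0 : ℝ≥0) = ⨆ j, if f j = 1 then 1 else 0 := by
  obtain ⟨j₀, hj₀⟩ := exists_eq_ciSup_of_finite (f := f)
  rw [← hj₀]
  refine le_antisymm (le_ciSup (f := fun j => if f j = 1 then (1 : ℝ≥0) else 0)
    (Set.finite_range _).bddAbove j₀) (ciSup_le fun j => ?_)
  split_ifs with h h₀
  · exact le_rfl
  · refine absurd (le_antisymm (hf j₀) ?_) h₀
    rw [← h, hj₀]
    exact le_ciSup (Set.finite_range f).bddAbove j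
  all_goals exact zero_le

theorem boolPart_maxMul {n : Type*} [Fintype n]
    (A B : Matrix n n ℝ≥0)
    (hA : ∀ i j, A i j ≤ 1) (hB : ∀ i j, B i j ≤ 1) :
    boolPart (maxMul A B) = maxMul (boolPart A) (boolPart B) := by
  ext1 i k
  have : Nonempty n := ⟨i⟩
  calc boolPart (maxMul A B) i k = ⨆ j, if A i j * B j k = 1 then 1 else 0 :=
        NNReal.iSup_ite_eq_one fun j => mul_le_one' (hA i j) (hB j k)
    _ = maxMul (boolPart A) (boolPart B) i k := iSup_congr fun j => by
        simp only [NNReal.mul_eq_one_iff_of_le_one (hA i j) (hB j k), boolPart, ite_and, ite_mul,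
          one_mul, zero_mul]
end

section
/- If n is a finite nonempty type and A, B : Matrix n n ℝ nonnegative matrices that commute (A * B = B * A), then A and B have a common nonnegative eigenvector: there exist a vector v : n → ℝ with v ≠ 0 and 0 ≤ v i for all i, and scalars α, β : ℝ, such that A.mulVec v = α • v and B.mulVec v = β • v. -/
namespace PointedCone

/-- A pointed cone in a finite-dimensional space has an order unit. -/
theorem exists_order_unit {E : Type*} [AddCommGroup E] [Module ℝ E] [FiniteDimensional ℝ E]
    (K : PointedCone ℝ E) :
    ∃ u ∈ K, ∀ x ∈ K, ∃ c : ℝ, 0 < c ∧ c • u - x ∈ K := by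
  classical
  obtain ⟨s, hsK, hspan⟩ := Submodule.fg_span_iff_fg_span_finset_subset (K : Set E) |>.1
    (IsNoetherian.noetherian (Submodule.span ℝ (K : Set E)))
  have hu : ∑ b ∈ s, b ∈ K := K.sum_mem fun b hb => hsK hb
  have key : ∀ x ∈ Submodule.span ℝ (s : Set E),
      ∃ c : ℝ, 0 ≤ c ∧ c • ∑ b ∈ s, b - x ∈ K ∧ c • ∑ b ∈ s, b + x ∈ K := by
    intro x hx
    induction hx using Submodule.span_induction with
    | mem x hx =>
      refine ⟨1, zero_le_one, ?_, ?_⟩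
      · rw [one_smul, ← Finset.sum_erase_add s _ hx, add_sub_cancel_right]
        exact K.sum_mem fun b hb => hsK (Finset.mem_of_mem_erase hb)
      · rw [one_smul]
        exact K.add_mem hu (hsK hx)
    | zero => exact ⟨0, le_rfl, by simp, by simp⟩
    | add x y _ _ hx hy =>
      obtain ⟨c, hc, h₁, h₂⟩ := hx
      obtain ⟨d, hd, h₃, h₄⟩ := hy
      refine ⟨c + d, add_nonneg hc hd, ?_, ?_⟩
      · convert K.add_mem h₁ h₃ using 1
        module
      · convert K.add_mem h₂ h₄ using 1
        module
    | smul r x _ hx =>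
      obtain ⟨c, hc, h₁, h₂⟩ := hx
      refine ⟨|r| * c, mul_nonneg (abs_nonneg r) hc, ?_⟩
      have h₃ := K.smul_mem (abs_nonneg r) h₁
      have h₄ := K.smul_mem (abs_nonneg r) h₂
      rcases abs_cases r with ⟨hr, _⟩ | ⟨hr, _⟩ <;> rw [hr] at h₃ h₄ ⊢
      · refine ⟨?_, ?_⟩
        · convert h₃ using 1
          module
        · convert h₄ using 1
          module
      · refine ⟨?_, ?_⟩
        · convert h₄ using 1
          module
        · convert h₃ using 1
          module
  refine ⟨_, hu, fun x hx => ?_⟩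
  obtain ⟨c, hc, h, -⟩ := key x (hspan ▸ Submodule.subset_span hx)
  refine ⟨c + 1, by positivity, ?_⟩
  convert K.add_mem h hu using 1
  module

variable {n : Type*} [Fintype n]

theorem isCompact_inter_stdSimplex {K : PointedCone ℝ (n → ℝ)}
    (hclosed : IsClosed (K : Set (n → ℝ))) : IsCompact ((K : Set (n → ℝ)) ∩ stdSimplex ℝ n) :=
  (isCompact_stdSimplex ℝ n).inter_left hclosed

theorem sum_pos_of_mem {K : PointedCone ℝ (n → ℝ)} (hpos : ∀ x ∈ K, 0 ≤ x)
    {x : n → ℝ} (hx : x ∈ K) (hx0 : x ≠ 0) : 0 < ∑ i, x i :=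
  Fintype.sum_pos (lt_of_le_of_ne (hpos x hx) hx0.symm)

theorem normalize_mem {K : PointedCone ℝ (n → ℝ)} (hpos : ∀ x ∈ K, 0 ≤ x)
    {x : n → ℝ} (hx : x ∈ K) (hx0 : x ≠ 0) :
    (∑ i, x i)⁻¹ • x ∈ (K : Set (n → ℝ)) ∩ stdSimplex ℝ n := by
  have hs := sum_pos_of_mem hpos hx hx0
  have hmem := K.smul_mem (inv_nonneg.2 hs.le) hx
  refine ⟨hmem, hpos _ hmem, ?_⟩
  simp only [Pi.smul_apply, smul_eq_mul, ← Finset.mul_sum]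
  exact inv_mul_cancel₀ hs.ne.symm

/-- A linear map sending every nonzero element of a closed cone of nonnegative vectors above a
positive multiple of an order unit has an eigenvector in the cone. -/
theorem exists_eigenvector_of_strongly_positive {K : PointedCone ℝ (n → ℝ)}
    (hclosed : IsClosed (K : Set (n → ℝ))) (hpos : ∀ x ∈ K, 0 ≤ x)
    (hne : ∃ x ∈ K, x ≠ 0) (L : (n → ℝ) →ₗ[ℝ] (n → ℝ)) (hL : ∀ x ∈ K, L x ∈ K)
    {u : n → ℝ} (hu : ∀ x ∈ K, ∃ c : ℝ, 0 < c ∧ c • u - x ∈ K)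
    (hLu : ∀ x ∈ K, x ≠ 0 → ∃ δ : ℝ, 0 < δ ∧ L x - δ • u ∈ K) :
    ∃ x ∈ (K : Set (n → ℝ)) ∩ stdSimplex ℝ n, ∃ μ : ℝ, L x = μ • x := by
  set S := (K : Set (n → ℝ)) ∩ stdSimplex ℝ n
  have hScomp : IsCompact S := isCompact_inter_stdSimplex hclosed
  have hLcont : Continuous L := L.continuous_of_finiteDimensional
  obtain ⟨M, hM⟩ := hScomp.bddAbove_image
    (f := fun x => ∑ i, L x i) (by fun_prop)
  let T : Set ((n → ℝ) × ℝ) := (S ×ˢ Set.Icc 0 M) ∩ {p | L p.1 - p.2 • p.1 ∈ K}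
  have hTcomp : IsCompact T :=
    (hScomp.prod isCompact_Icc).inter_right (hclosed.preimage (by fun_prop))
  have hT : ∀ x ∈ S, ∀ μ : ℝ, 0 ≤ μ → L x - μ • x ∈ K → (x, μ) ∈ T := by
    intro x hx μ hμ h
    refine ⟨⟨hx, hμ, le_trans ?_ (hM ⟨x, hx, rfl⟩)⟩, h⟩
    have h0 : 0 ≤ ∑ i, (L x - μ • x) i := Finset.sum_nonneg fun i _ => hpos _ h i
    simp only [Pi.sub_apply, Pi.smul_apply, smul_eq_mul, Finset.sum_sub_distrib,
      ← Finset.mul_sum, hx.2.2] at h0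
    linarith
  obtain ⟨w, hw, hw0⟩ := hne
  have hTne : T.Nonempty :=
    ⟨_, hT _ (normalize_mem hpos hw hw0) 0 le_rfl
      (by simpa using hL _ (normalize_mem hpos hw hw0).1)⟩
  obtain ⟨⟨x, μ⟩, ⟨⟨hxS, hμ⟩, hxμ⟩, hmax⟩ := hTcomp.exists_isMaxOn hTne continuous_snd.continuousOn
  refine ⟨x, hxS, μ, ?_⟩
  by_contra hneq
  simp only [Set.mem_ofPred_eq] at hxS hμ hxμ
  have hy0 : L x - μ • x ≠ 0 := sub_ne_zero.2 hneq
  have hLx0 : L x ≠ 0 := by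
    intro h
    apply hy0
    have h₁ := hpos _ hxμ
    have h₂ := hpos _ (K.smul_mem hμ.1 hxS.1)
    rw [h, zero_sub] at h₁ ⊢
    exact le_antisymm (neg_nonpos.2 h₂) h₁
  have hLx := hL x hxS.1
  obtain ⟨δ, hδ, hδu⟩ := hLu _ hxμ hy0
  obtain ⟨c, hc, hcu⟩ := hu _ hLx
  have hincr : L (L x) - (μ + δ / c) • L x ∈ K := by
    convert K.add_mem hδu (K.smul_mem (div_nonneg hδ.le hc.le) hcu) using 1
    rw [map_sub, map_smul, smul_sub, smul_smul, div_mul_cancel₀ _ hc.ne.symm]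
    module
  have hs := sum_pos_of_mem hpos hLx hLx0
  have hmem := hT _ (normalize_mem hpos hLx hLx0) (μ + δ / c)
    (add_nonneg hμ.1 (div_nonneg hδ.le hc.le)) (by
      convert K.smul_mem (inv_nonneg.2 hs.le) hincr using 1
      rw [map_smul]
      module)
  have hle : μ + δ / c ≤ μ := hmax hmem
  have := div_pos hδ hc
  linarith

/-- A linear map preserving a nonzero closed cone of nonnegative vectors has an eigenvector in
the cone. -/
theorem exists_eigenvector {K : PointedCone ℝ (n → ℝ)}
    (hclosed : IsClosed (K : Set (n → ℝ))) (hpos : ∀ x ∈ K, 0 ≤ x)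
    (hne : ∃ x ∈ K, x ≠ 0) (L : (n → ℝ) →ₗ[ℝ] (n → ℝ)) (hL : ∀ x ∈ K, L x ∈ K) :
    ∃ x ∈ K, x ≠ 0 ∧ ∃ μ : ℝ, L x = μ • x := by
  obtain ⟨u, huK, hu⟩ := K.exists_order_unit
  have hLcont : Continuous L := L.continuous_of_finiteDimensional
  let φ : (n → ℝ) →ₗ[ℝ] ℝ := ∑ i, LinearMap.proj i
  have hφ : ∀ x, φ x = ∑ i, x i := fun x => by simp [φ]
  have hφcont : Continuous φ := φ.continuous_of_finiteDimensional
  let Lε : ℝ → (n → ℝ) →ₗ[ℝ] (n → ℝ) := fun ε => L + ε • φ.smulRight u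
  have hLε : ∀ ε x, Lε ε x = L x + ε • φ x • u := fun ε x => rfl
  let T : Set (ℝ × (n → ℝ)) := (Set.Icc 0 1 ×ˢ ((K : Set (n → ℝ)) ∩ stdSimplex ℝ n)) ∩
    {p | Lε p.1 p.2 = φ (Lε p.1 p.2) • p.2}
  have hT : IsCompact T := by
    refine (isCompact_Icc.prod (isCompact_inter_stdSimplex hclosed)).inter_right
      (isClosed_eq ?_ ?_) <;> simp only [hLε] <;> fun_prop
  have hsub : Set.Ioc (0 : ℝ) 1 ⊆ Prod.fst '' T := by
    rintro ε ⟨hε, hε1⟩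
    obtain ⟨x, hx, μ, hμ⟩ := exists_eigenvector_of_strongly_positive hclosed hpos hne (Lε ε)
      (fun x hx => K.add_mem (hL x hx) (K.smul_mem hε.le (K.smul_mem
        (by rw [hφ]; exact Finset.sum_nonneg fun i _ => hpos x hx i) huK))) hu
      (fun x hx hx0 => ⟨ε * φ x, mul_pos hε (by rw [hφ]; exact sum_pos_of_mem hpos hx hx0), by
        rw [hLε, smul_smul, add_sub_cancel_right]
        exact hL x hx⟩)
    refine ⟨(ε, x), ⟨⟨⟨hε.le, hε1⟩, hx⟩, ?_⟩, rfl⟩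
    simp only [Set.mem_ofPred_eq]
    rw [hμ, map_smul, hφ, hx.2.2, smul_eq_mul, mul_one]
  have h0 : (0 : ℝ) ∈ Prod.fst '' T := by
    apply closure_minimal hsub (hT.image continuous_fst).isClosed
    rw [closure_Ioc zero_ne_one]
    exact ⟨le_rfl, zero_le_one⟩
  obtain ⟨⟨ε, x⟩, ⟨⟨-, hx⟩, hxT⟩, rfl : ε = 0⟩ := h0
  refine ⟨x, hx.1, ?_, φ (L x), by simpa [hLε] using hxT⟩
  rintro rfl
  simpa using hx.2.2

end PointedCone

theorem commuting_nonneg_common_eigenvector {n : Type*} [Fintype n] [Nonempty n]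
    (A B : Matrix n n ℝ)
    (hA : ∀ i j, 0 ≤ A i j) (hB : ∀ i j, 0 ≤ B i j)
    (hcomm : A * B = B * A) :
    ∃ (v : n → ℝ) (α β : ℝ), v ≠ 0 ∧ (∀ i, 0 ≤ v i) ∧
      A.mulVec v = α • v ∧ B.mulVec v = β • v := by
  have mulVec_nonneg : ∀ {C : Matrix n n ℝ}, (∀ i j, 0 ≤ C i j) → ∀ x : n → ℝ, 0 ≤ x →
      0 ≤ C.mulVec x := fun hC x hx i => Finset.sum_nonneg fun j _ => mul_nonneg (hC i j) (hx j)
  have hmem : ∀ x : n → ℝ, x ∈ PointedCone.positive ℝ (n → ℝ) ↔ 0 ≤ x :=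
    fun x => PointedCone.mem_positive ℝ (n → ℝ)
  obtain ⟨x, hx, hx0, α, hα⟩ := PointedCone.exists_eigenvector
    (K := PointedCone.positive ℝ (n → ℝ)) isClosed_Ici (fun x hx => (hmem x).1 hx)
    ⟨1, (hmem 1).2 zero_le_one, one_ne_zero⟩ A.mulVecLin
    (fun x hx => (hmem _).2 (mulVec_nonneg hA x ((hmem x).1 hx)))
  let E : Submodule ℝ (n → ℝ) := LinearMap.ker (A.mulVecLin - α • LinearMap.id)
  have hE : ∀ x, x ∈ E ↔ A.mulVec x = α • x := fun x => by
    simp [E, LinearMap.mem_ker, sub_eq_zero]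
  let K : PointedCone ℝ (n → ℝ) := PointedCone.positive ℝ (n → ℝ) ⊓ E.restrictScalars _
  have hK : ∀ x, x ∈ K ↔ 0 ≤ x ∧ A.mulVec x = α • x := fun x =>
    and_congr (hmem x) (hE x)
  obtain ⟨v, hv, hv0, β, hβ⟩ := PointedCone.exists_eigenvector (K := K)
    (isClosed_Ici.inter E.closed_of_finiteDimensional) (fun x hx => ((hK x).1 hx).1)
    ⟨x, (hK x).2 ⟨(hmem x).1 hx, hα⟩, hx0⟩ B.mulVecLin (fun x hx => by
      obtain ⟨h₁, h₂⟩ := (hK x).1 hx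
      refine (hK _).2 ⟨mulVec_nonneg hB x h₁, ?_⟩
      rw [Matrix.mulVecLin_apply, Matrix.mulVec_mulVec, hcomm, ← Matrix.mulVec_mulVec, h₂,
        Matrix.mulVec_smul])
  exact ⟨v, α, β, hv0, ((hK v).1 hv).1, ((hK v).1 hv).2, hβ⟩
end

section
/- Let A : Fin r → Matrix n n ℝ be nonnegative matrices over a finite type n that commute in pairs (A i * A j = A j * A i for all i, j). Given i₀ : Fin r and a distinguished eigenvalue α₀ of A i₀ (there exists a nonnegative v ≠ 0 with (A i₀).mulVec v = α₀ • v), there exist a function α : Fin r → ℝ with α i₀ = α₀ and a nonnegative vector u : n → ℝ with u ≠ 0 such that (A i).mulVec u = α i • u for every i : Fin r; in particular all the matrices A i have a common nonnegative eigenvector. -/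
section PositiveEigenvector

variable {n : Type*} [Fintype n]

/-- A closed cone in the nonnegative orthant meets the region of bounded coordinate sum in a
compact set. -/
theorem isCompact_cone_inter_sum_le {K : PointedCone ℝ (n → ℝ)}
    (hK : IsClosed (K : Set (n → ℝ))) (hpos : ∀ x ∈ K, 0 ≤ x) (c : ℝ) :
    IsCompact {x : n → ℝ | x ∈ K ∧ ∑ i, x i ≤ c} := by
  refine (isCompact_Icc (a := (0 : n → ℝ)) (b := fun _ => c)).of_isClosed_subset ?_ ?_
  · exact hK.inter (isClosed_le (f := fun x : n → ℝ => ∑ i, x i) (by fun_prop) continuous_const)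
  · rintro x ⟨hx, hc⟩
    exact ⟨hpos x hx, fun i =>
      (Finset.single_le_sum (fun j _ => hpos x hx j) (Finset.mem_univ i)).trans hc⟩

theorem eq_zero_of_nonneg_of_sum_nonpos {x : n → ℝ} (hx : 0 ≤ x) (h : ∑ i, x i ≤ 0) : x = 0 := by
  have h0 := (Finset.sum_eq_zero_iff_of_nonneg (fun i _ => hx i)).1
    (le_antisymm h (Finset.sum_nonneg fun i _ => hx i))
  exact funext fun i => h0 i (Finset.mem_univ i)

/-- A cone in a finite-dimensional space has an order unit. -/
theorem PointedCone.exists_orderUnit {E : Type*} [AddCommGroup E] [Module ℝ E]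
    [FiniteDimensional ℝ E] (K : PointedCone ℝ E) :
    ∃ w ∈ K, ∀ x ∈ K, ∃ C : ℝ, 0 < C ∧ C • w - x ∈ K := by
  obtain ⟨b, hbK, hspan, hli⟩ := exists_linearIndependent ℝ (K : Set E)
  have hfin : b.Finite := hli.setFinite
  obtain ⟨s, rfl⟩ := hfin.exists_finset_coe
  refine ⟨∑ y ∈ s, y, K.sum_mem fun y hy => hbK hy, fun x hx => ?_⟩
  have hx' : x ∈ Submodule.span ℝ (s : Set E) := hspan ▸ Submodule.subset_span hx
  obtain ⟨f, -, rfl⟩ := Submodule.mem_span_finset.1 hx'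
  refine ⟨1 + ∑ y ∈ s, |f y|, by positivity, ?_⟩
  rw [Finset.smul_sum, ← Finset.sum_sub_distrib]
  refine K.sum_mem fun y hy => ?_
  rw [← sub_smul]
  refine K.smul_mem ?_ (hbK hy)
  have := Finset.single_le_sum (f := fun y => |f y|) (fun y _ => abs_nonneg (f y)) hy
  have := le_abs_self (f y)
  linarith

variable {K : PointedCone ℝ (n → ℝ)} {T : (n → ℝ) →ₗ[ℝ] (n → ℝ)}

/-- A supersolution of `c • y - T y = w` in a closed cone yields a solution. -/
theorem exists_resolvent_solution_of_supersolution
    (hK : IsClosed (K : Set (n → ℝ))) (hpos : ∀ x ∈ K, 0 ≤ x) (hT : ∀ x ∈ K, T x ∈ K)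
    {c : ℝ} (hc : 0 < c) {w x : n → ℝ} (hw : w ∈ K) (hx : x ∈ K) (h : c • x - T x - w ∈ K) :
    ∃ y ∈ K, c • y - T y = w := by
  have hTc : Continuous T := T.continuous_of_finiteDimensional
  have hS : IsCompact ({y : n → ℝ | y ∈ K ∧ ∑ i, y i ≤ ∑ i, x i} ∩
      {y | c • y - T y - w ∈ K}) :=
    (isCompact_cone_inter_sum_le hK hpos _).inter_right (hK.preimage (by fun_prop))
  obtain ⟨y, ⟨⟨hyK, hyx⟩, hy⟩, hmin⟩ := hS.exists_isMinOn ⟨x, ⟨hx, le_rfl⟩, h⟩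
    (f := fun y => ∑ i, y i) (by fun_prop)
  refine ⟨y, hyK, ?_⟩
  set d : n → ℝ := c⁻¹ • (c • y - T y - w) with hd
  have hdK : d ∈ K := K.smul_mem (inv_nonneg.2 hc.le) hy
  have hcd : c • d = c • y - T y - w := by rw [hd, smul_inv_smul₀ hc.ne']
  have hy' : y - d = c⁻¹ • (T y + w) := by
    have : c • (y - d) = T y + w := by rw [smul_sub, hcd]; abel
    rw [← this, inv_smul_smul₀ hc.ne']
  have hsum : ∑ i, (y - d) i = ∑ i, y i - ∑ i, d i := by simp
  have hd0 : 0 ≤ ∑ i, d i := Finset.sum_nonneg fun i _ => hpos d hdK i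
  have hmem : y - d ∈ {y : n → ℝ | y ∈ K ∧ ∑ i, y i ≤ ∑ i, x i} ∩
      {y | c • y - T y - w ∈ K} := by
    refine ⟨⟨?_, by linarith⟩, ?_⟩
    · rw [hy']
      exact K.smul_mem (inv_nonneg.2 hc.le) (K.add_mem (hT y hyK) hw)
    · have : c • (y - d) - T (y - d) - w = T d := by
        rw [smul_sub, hcd, map_sub]; abel
      change _ ∈ K
      rw [this]
      exact hT d hdK
  have hle : ∑ i, y i ≤ ∑ i, (y - d) i := hmin hmem
  have hdz : d = 0 := eq_zero_of_nonneg_of_sum_nonpos (hpos d hdK) (by linarith)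
  rw [hdz, smul_zero] at hcd
  exact (sub_eq_zero.1 hcd.symm)

/-- A linear map preserving a nonzero closed cone in the nonnegative orthant has an eigenvector in
that cone. -/
theorem exists_eigenvector_mem_of_mapsTo_cone
    (hK : IsClosed (K : Set (n → ℝ))) (hpos : ∀ x ∈ K, 0 ≤ x) (hT : ∀ x ∈ K, T x ∈ K)
    (hne : ∃ v ∈ K, v ≠ 0) : ∃ (c : ℝ) (u : n → ℝ), u ∈ K ∧ u ≠ 0 ∧ T u = c • u := by
  have hTc : Continuous T := T.continuous_of_finiteDimensional
  obtain ⟨w, hw, hunit⟩ := K.exists_orderUnit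
  have hsum_pos : ∀ x ∈ K, x ≠ 0 → 0 < ∑ i, x i := fun x hx hx0 => by
    by_contra! h
    exact hx0 (eq_zero_of_nonneg_of_sum_nonpos (hpos x hx) h)
  have hw0 : w ≠ 0 := by
    rintro rfl
    obtain ⟨v, hv, hv0⟩ := hne
    obtain ⟨C, -, hC⟩ := hunit v hv
    rw [smul_zero, zero_sub] at hC
    refine hv0 (le_antisymm ?_ (hpos v hv))
    simpa using hpos _ hC
  have hws := hsum_pos w hw hw0
  obtain ⟨L, hL, hLw⟩ := hunit (T w) (hT w hw)
  -- Supersolutions give normalized solutions of `c • u - T u = t • w`.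
  have hnorm : ∀ c : ℝ, 0 < c → ∀ x ∈ K, c • x - T x - w ∈ K →
      ∃ u ∈ K, ∑ i, u i = 1 ∧ ∃ t : ℝ, 0 ≤ t ∧ c • u - T u = t • w := by
    intro c hc x hx h
    obtain ⟨y, hy, hyw⟩ := exists_resolvent_solution_of_supersolution hK hpos hT hc hw hx h
    have hy0 : y ≠ 0 := by
      rintro rfl
      exact hw0 (by simpa using hyw.symm)
    have hs := hsum_pos y hy hy0
    refine ⟨(∑ i, y i)⁻¹ • y, K.smul_mem (inv_nonneg.2 hs.le) hy, ?_,
      (∑ i, y i)⁻¹, inv_nonneg.2 hs.le, ?_⟩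
    · simp only [Pi.smul_apply, smul_eq_mul, ← Finset.mul_sum]
      exact inv_mul_cancel₀ hs.ne'
    · rw [← hyw, map_smul, smul_sub, smul_comm]
  have hsum_eq : ∀ (c t : ℝ) (u : n → ℝ), ∑ i, u i = 1 → c • u - T u = t • w →
      t * ∑ i, w i = c - ∑ i, T u i := by
    intro c t u hu h
    have := congrArg (fun z : n → ℝ => ∑ i, z i) h
    simp only [Pi.sub_apply, Pi.smul_apply, smul_eq_mul, Finset.sum_sub_distrib,
      ← Finset.mul_sum, hu, mul_one] at this
    exact this.symm
  have hTs : ∀ u ∈ K, 0 ≤ ∑ i, T u i := fun u hu =>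
    Finset.sum_nonneg fun i _ => hpos _ (hT u hu) i
  have hbound : ∀ (c t : ℝ) (u : n → ℝ), u ∈ K → c ≤ L + 1 → ∑ i, u i = 1 →
      c • u - T u = t • w → t ≤ (L + 1) / ∑ i, w i := by
    intro c t u hu hc h1 h
    rw [le_div_iff₀ hws]
    linarith [hsum_eq c t u h1 h, hTs u hu]
  let S : Set (ℝ × (n → ℝ) × ℝ) :=
    (Set.Icc 0 (L + 1) ×ˢ {x : n → ℝ | x ∈ K ∧ ∑ i, x i ≤ 1} ×ˢ
      Set.Icc 0 ((L + 1) / ∑ i, w i)) ∩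
      {p | ∑ i, p.2.1 i = 1 ∧ p.1 • p.2.1 - T p.2.1 = p.2.2 • w}
  have hS : IsCompact S := by
    refine (isCompact_Icc.prod ((isCompact_cone_inter_sum_le hK hpos 1).prod
      isCompact_Icc)).inter_right ?_
    exact (isClosed_eq (by fun_prop) continuous_const).inter
      (isClosed_eq (by fun_prop) (by fun_prop))
  have hSmem : ∀ c : ℝ, 0 < c → c ≤ L + 1 → ∀ x ∈ K, c • x - T x - w ∈ K →
      ∃ q ∈ S, q.1 = c := by
    intro c hc hcL x hx h
    obtain ⟨u, hu, hu1, t, ht, hut⟩ := hnorm c hc x hx h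
    exact ⟨(c, u, t), ⟨⟨⟨hc.le, hcL⟩, ⟨hu, hu1.le⟩, ht, hbound c t u hu hcL hu1 hut⟩,
      hu1, hut⟩, rfl⟩
  obtain ⟨p, hp, -⟩ := hSmem (L + 1) (by linarith) le_rfl w hw (by
    convert hLw using 1
    rw [add_smul, one_smul]; abel)
  obtain ⟨⟨c, u, t⟩, ⟨⟨⟨hc0, hcL⟩, ⟨hu, -⟩, ht0, -⟩, hu1, hut⟩, hmin⟩ :=
    hS.exists_isMinOn ⟨p, hp⟩ (f := fun p => p.1) (by fun_prop)
  simp only at hc0 hcL hu ht0 hu1 hut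
  have hu0 : u ≠ 0 := by
    rintro rfl
    simp at hu1
  refine ⟨c, u, hu, hu0, ?_⟩
  rcases ht0.eq_or_lt with rfl | ht
  · rw [zero_smul, sub_eq_zero] at hut
    exact hut.symm
  exfalso
  have hc : 0 < c := by
    have := mul_pos ht hws
    linarith [hsum_eq c t u hu1 hut, hTs u hu]
  obtain ⟨C, hC, hCu⟩ := hunit u hu
  -- Lowering `c` by `ε` keeps `(2 / t) • u` a supersolution.
  set ε : ℝ := min (c / 2) (t / (2 * C)) with hε
  have hε0 : 0 < ε := by positivity
  have hεc : ε < c := (min_le_left _ _).trans_lt (by linarith)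
  have hεC : ε * C ≤ t / 2 := by
    have := mul_le_mul_of_nonneg_right (min_le_right (c / 2) (t / (2 * C))) hC.le
    calc ε * C ≤ t / (2 * C) * C := this
      _ = t / 2 := by field_simp
  obtain ⟨q, hq, hqc⟩ := hSmem (c - ε) (by linarith) (by linarith) ((2 / t) • u)
    (K.smul_mem (by positivity) hu) (by
      have key : (c - ε) • ((2 / t) • u) - T ((2 / t) • u) - w
          = (2 / t) • (ε • (C • w - u) + (t / 2 - ε * C) • w) := by
        have hTu : T u = c • u - t • w := by rw [← hut]; abel
        rw [map_smul, hTu]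
        ext i
        simp only [Pi.sub_apply, Pi.smul_apply, Pi.add_apply, smul_eq_mul]
        field_simp
        ring
      rw [key]
      exact K.smul_mem (by positivity) (K.add_mem (K.smul_mem hε0.le hCu)
        (K.smul_mem (by linarith) hw)))
  have : c ≤ q.1 := hmin hq
  linarith

end PositiveEigenvector

/-- The cone of nonnegative vectors satisfying `A i *ᵥ u = α i • u` for all `i` in `s`. -/
def nonnegEigenCone {n ι : Type*} [Fintype n] (A : ι → Matrix n n ℝ) (α : ι → ℝ) (s : Set ι) :
    PointedCone ℝ (n → ℝ) where
  carrier := {u | 0 ≤ u ∧ ∀ i ∈ s, (A i).mulVec u = α i • u}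
  zero_mem' := ⟨le_rfl, fun i _ => by simp⟩
  add_mem' := fun ⟨hx, hx'⟩ ⟨hy, hy'⟩ =>
    ⟨add_nonneg hx hy, fun i hi => by rw [Matrix.mulVec_add, hx' i hi, hy' i hi, smul_add]⟩
  smul_mem' := fun c x ⟨hx, hx'⟩ => by
    refine ⟨fun i => mul_nonneg c.2 (hx i), fun i hi => ?_⟩
    change (A i).mulVec ((c : ℝ) • x) = α i • ((c : ℝ) • x)
    rw [Matrix.mulVec_smul, hx' i hi, smul_comm]

theorem isClosed_nonnegEigenCone {n ι : Type*} [Fintype n] (A : ι → Matrix n n ℝ) (α : ι → ℝ)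
    (s : Set ι) : IsClosed (nonnegEigenCone A α s : Set (n → ℝ)) := by
  have : (nonnegEigenCone A α s : Set (n → ℝ)) =
      Set.Ici 0 ∩ ⋂ i ∈ s, {u | (A i).mulVec u = α i • u} := by
    ext u
    simp only [Set.mem_inter_iff, Set.mem_iInter]
    rfl
  rw [this]
  exact isClosed_Ici.inter (isClosed_biInter fun i _ =>
    isClosed_eq (by fun_prop) (by fun_prop))

theorem pairwise_commuting_nonneg_common_eigenvector {n : Type*} [Fintype n] {r : ℕ}
    (A : Fin r → Matrix n n ℝ)
    (hA : ∀ k, ∀ i j, 0 ≤ A k i j)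
    (hcomm : ∀ i j : Fin r, A i * A j = A j * A i)
    (i₀ : Fin r) (α₀ : ℝ)
    (hα₀ : ∃ v : n → ℝ, v ≠ 0 ∧ (∀ i, 0 ≤ v i) ∧ (A i₀).mulVec v = α₀ • v) :
    ∃ (α : Fin r → ℝ) (u : n → ℝ), α i₀ = α₀ ∧ u ≠ 0 ∧ (∀ i, 0 ≤ u i) ∧
      ∀ i : Fin r, (A i).mulVec u = α i • u := by
  suffices H : ∀ s : Finset (Fin r), ∃ (α : Fin r → ℝ) (u : n → ℝ), α i₀ = α₀ ∧ u ≠ 0 ∧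
      u ∈ nonnegEigenCone A α (insert i₀ (s : Set (Fin r))) by
    obtain ⟨α, u, h₀, hu, hu0, h⟩ := H Finset.univ
    exact ⟨α, u, h₀, hu, hu0, fun i => h i (by simp)⟩
  intro s
  induction s using Finset.induction_on with
  | empty =>
    obtain ⟨v, hv, hv0, h⟩ := hα₀
    refine ⟨fun _ => α₀, v, rfl, hv, hv0, fun i hi => ?_⟩
    obtain rfl : i = i₀ := by simpa using hi
    exact h
  | insert a s ha ih =>
    obtain ⟨α, v, h₀, hv, hvK⟩ := ih
    rcases eq_or_ne a i₀ with rfl | hai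
    · exact ⟨α, v, h₀, hv, by simpa using hvK⟩
    obtain ⟨c, u, ⟨hu0, hu⟩, hune, huc⟩ := exists_eigenvector_mem_of_mapsTo_cone
      (T := (A a).mulVecLin) (isClosed_nonnegEigenCone A α (insert i₀ (s : Set (Fin r))))
      (fun x hx => hx.1) (fun x ⟨hx0, hx⟩ => by
        refine ⟨fun i => Finset.sum_nonneg fun j _ => mul_nonneg (hA a i j) (hx0 j),
          fun i hi => ?_⟩
        rw [Matrix.mulVecLin_apply, Matrix.mulVec_mulVec, hcomm, ← Matrix.mulVec_mulVec,
          hx i hi, Matrix.mulVec_smul]) ⟨v, hvK, hv⟩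
    refine ⟨Function.update α a c, u, by rw [Function.update_of_ne hai.symm, h₀], hune, hu0,
      fun i hi => ?_⟩
    rcases eq_or_ne i a with rfl | hia
    · simpa using huc
    · rw [Function.update_of_ne hia]
      refine hu i ?_
      simpa [hia] using hi
end
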